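/- Let D be a B-regular bounded domain in ℂⁿ, let A ⊆ ∂D be b-pluripolar, let F be an F_σ set and G a G_δ set in cl(D) such that F ⊆ Â ⊆ G. Then there exists a function ψ ∈ PSH(D) with ψ < 0 and ψ not identically -∞ such that the set E = {z ∈ cl(D) : ψ*(z) = -∞} satisfies F ⊆ E ⊆ G. -/

import Mathlib

open Complex Metric MeasureTheory Filter Topology Set

noncomputable section

/-- The average of the truncation `max u (-m)` of an `EReal`-valued function `u` over the
circle of center `c` and radius `r`. -/
noncomputable def truncCircleAvg (u : ℂ → EReal) (c : ℂ) (r : ℝ) (m : ℕ) : ℝ :=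
  (2 * Real.pi)⁻¹ *
    ∫ θ in (0:ℝ)..(2 * Real.pi),
      (max (u (c + (r : ℂ) * Complex.exp (θ * Complex.I))) ((-(m : ℝ) : ℝ) : EReal)).toReal

/-- A `[-∞,∞]`-valued function is subharmonic on `U ⊆ ℂ` if it is upper semicontinuous
on `U` and satisfies the sub-mean value inequality on every closed disc contained in `U`
(expressed via averages of truncations from below). -/
def SubharmonicOn (u : ℂ → EReal) (U : Set ℂ) : Prop :=
  UpperSemicontinuousOn u U ∧
    ∀ c r, 0 < r → Metric.closedBall c r ⊆ U →
      ∀ m : ℕ, u c ≤ ((truncCircleAvg u c r m : ℝ) : EReal)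

variable {E : Type*} [NormedAddCommGroup E] [NormedSpace ℂ E]

/-- Plurisubharmonic on `D`: upper semicontinuous on `D`, with values in `[-∞, ∞)`,
whose restriction to every complex line is subharmonic.  (The constant `-∞` is allowed
here; the paper's class `PSH(D)` additionally requires `u ≢ -∞`, see `MemPSH`.) -/
def PshOn (u : E → EReal) (D : Set E) : Prop :=
  UpperSemicontinuousOn u D ∧ (∀ z ∈ D, u z ≠ ⊤) ∧
    ∀ a b : E, SubharmonicOn (fun ζ : ℂ => u (a + ζ • b)) {ζ : ℂ | a + ζ • b ∈ D}

/-- Membership in the paper's class `PSH(D)`: plurisubharmonic and not identically `-∞`. -/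
def MemPSH (u : E → EReal) (D : Set E) : Prop :=
  PshOn u D ∧ ∃ z ∈ D, u z ≠ ⊥

/-- The upper semicontinuous regularization `u*` of `u` on `cl(D)`:
`u*(x) = limsup_{z → x, z ∈ D} u(z)`. -/
noncomputable def uscReg (u : E → EReal) (D : Set E) (x : E) : EReal :=
  Filter.limsup u (nhdsWithin x D)

/-- The boundary relative extremal function
`ω(z, A, D) = sup { u(z) : u ∈ PSH(D), u ≤ 0 on D, u* ≤ -1 on A }`. -/
noncomputable def bndExt (z : E) (A D : Set E) : EReal :=
  sSup {w : EReal | ∃ u : E → EReal, MemPSH u D ∧ (∀ y ∈ D, u y ≤ 0) ∧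
    (∀ x ∈ A, uscReg u D x ≤ -1) ∧ w = u z}

/-- The upper semicontinuous regularization `ω*(·, A, D)` on `cl(D)`. -/
noncomputable def bndExtStar (x : E) (A D : Set E) : EReal :=
  Filter.limsup (fun z => bndExt z A D) (nhdsWithin x D)

/-- A bounded domain: a nonempty connected bounded open set. -/
def IsBddDomain (D : Set E) : Prop :=
  IsOpen D ∧ IsConnected D ∧ Bornology.IsBounded D

/-- `A ⊆ ∂D` is b-pluripolar if there is `u ∈ PSH(D)`, `u ≤ 0`, `u ≢ -∞`,
with `u* = -∞` on `A`. -/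
def BPluripolar (A D : Set E) : Prop :=
  ∃ u : E → EReal, PshOn u D ∧ (∀ z ∈ D, u z ≤ 0) ∧ (∃ z ∈ D, u z ≠ ⊥) ∧
    ∀ x ∈ A, uscReg u D x = ⊥

/-- The b-pluripolar hull `Â` of `A ⊆ ∂D`: all points `z ∈ cl(D)` such that `u*(z) = -∞`
for every negative `u ∈ PSH(D)`, `u ≢ -∞`, with `u* = -∞` on `A`. -/
def bHull (A D : Set E) : Set E :=
  {z ∈ closure D | ∀ u : E → EReal, PshOn u D → (∀ y ∈ D, u y < 0) →
    (∃ y ∈ D, u y ≠ ⊥) → (∀ x ∈ A, uscReg u D x = ⊥) → uscReg u D z = ⊥}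

/-- Weak regularity: for every relatively open `U ⊆ ∂D` one has `ω*(·, U, D) ≤ -1` on `U`. -/
def WeaklyRegular (D : Set E) : Prop :=
  ∀ U W : Set E, IsOpen W → U = W ∩ frontier D → ∀ x ∈ U, bndExtStar x U D ≤ -1

/-- B-regularity (Sibony): every continuous `f : ∂D → ℝ` extends to a function
plurisubharmonic on `D` and continuous on `cl(D)` with boundary values `f`. -/
def BRegular (D : Set E) : Prop :=
  ∀ f : E → ℝ, ContinuousOn f (frontier D) →
    ∃ F : E → ℝ, ContinuousOn F (closure D) ∧
      PshOn (fun z => ((F z : ℝ) : EReal)) D ∧ ∀ x ∈ frontier D, F x = f x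

/-- The extremal function `ω₁(z, K, D)`, defined with continuous-up-to-the-boundary
plurisubharmonic competitors. -/
noncomputable def bndExtCont (z : E) (K D : Set E) : EReal :=
  sSup {w : EReal | ∃ F : E → ℝ, ContinuousOn F (closure D) ∧
    PshOn (fun y => ((F y : ℝ) : EReal)) D ∧ (∀ y ∈ closure D, F y ≤ 0) ∧
    (∀ x ∈ K, F x ≤ -1) ∧ w = ((F z : ℝ) : EReal)}

end

open Complex Metric MeasureTheory Filter Topology Set

/-- truncation -/
noncomputable def trc (f : ℂ → EReal) (m : ℕ) (ζ : ℂ) : ℝ :=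
  (max (f ζ) ((-(m : ℝ) : ℝ) : EReal)).toReal

lemma coe_trc {f : ℂ → EReal} {m : ℕ} {ζ : ℂ} (h : f ζ ≠ ⊤) :
    ((trc f m ζ : ℝ) : EReal) = max (f ζ) ((-(m : ℝ) : ℝ) : EReal) := by
  unfold trc
  rw [EReal.coe_toReal]
  · exact (max_lt (lt_top_iff_ne_top.2 h) (EReal.coe_lt_top _)).ne
  · exact (lt_of_lt_of_le (EReal.bot_lt_coe _) (le_max_right _ _)).ne'

lemma trc_ge {f : ℂ → EReal} {m : ℕ} {ζ : ℂ} (h : f ζ ≠ ⊤) : -(m:ℝ) ≤ trc f m ζ := by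
  rw [← EReal.coe_le_coe_iff, coe_trc h]; exact le_max_right _ _

lemma le_trc {f : ℂ → EReal} {m : ℕ} {ζ : ℂ} (h : f ζ ≠ ⊤) : f ζ ≤ (trc f m ζ : ℝ) := by
  rw [coe_trc h]; exact le_max_left _ _

lemma trc_le {f : ℂ → EReal} {m : ℕ} {ζ : ℂ} {M : ℝ} (h : f ζ ≠ ⊤) (h1 : f ζ ≤ M) (h2 : -(m:ℝ) ≤ M) :
    trc f m ζ ≤ M := by
  rw [← EReal.coe_le_coe_iff, coe_trc h]; exact max_le h1 (by exact_mod_cast h2)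

lemma trc_lt {f : ℂ → EReal} {m : ℕ} {ζ : ℂ} {M : ℝ} (h : f ζ ≠ ⊤) :
    trc f m ζ < M ↔ f ζ < M ∧ -(m:ℝ) < M := by
  rw [← EReal.coe_lt_coe_iff, coe_trc h, max_lt_iff, EReal.coe_lt_coe_iff]

lemma sph_ne : (sphere (0:ℂ) 1).Nonempty := ⟨1, by simp⟩

lemma usc_bdd {f : ℂ → EReal} (hf : UpperSemicontinuousOn f (sphere 0 1))
    (ht : ∀ ζ ∈ sphere (0:ℂ) 1, f ζ ≠ ⊤) : ∃ M : ℝ, 0 ≤ M ∧ ∀ ζ ∈ sphere (0:ℂ) 1, f ζ ≤ M := by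
  obtain ⟨p, hp, hmax⟩ := hf.exists_isMaxOn sph_ne (isCompact_sphere 0 1)
  refine ⟨max (f p).toReal 0, le_max_right _ _, fun ζ hζ => (hmax hζ).trans ?_⟩
  refine (EReal.le_coe_toReal (ht p hp)).trans ?_
  exact_mod_cast le_max_left _ _

lemma trc_integrable {f : ℂ → EReal} (hf : UpperSemicontinuousOn f (sphere 0 1))
    (ht : ∀ ζ ∈ sphere (0:ℂ) 1, f ζ ≠ ⊤) (m : ℕ) : CircleIntegrable (trc f m) 0 1 := by
  obtain ⟨M, hM0, hM⟩ := usc_bdd hf ht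
  have hmem : ∀ θ : ℝ, circleMap (0:ℂ) 1 θ ∈ sphere (0:ℂ) 1 := fun θ => by
    simp
  have husc : UpperSemicontinuous (fun θ : ℝ => f (circleMap 0 1 θ)) := by
    rw [← upperSemicontinuousOn_univ_iff]
    exact hf.comp (continuous_circleMap 0 1).continuousOn (fun θ _ => hmem θ)
  have hmeas : Measurable (fun θ : ℝ => trc f m (circleMap 0 1 θ)) := by
    unfold trc
    exact (husc.measurable.max measurable_const).ereal_toReal
  unfold CircleIntegrable
  refine (intervalIntegrable_const (c := max M m)).mono_fun hmeas.aestronglyMeasurable ?_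
  refine Eventually.of_forall fun θ => ?_
  simp only [Real.norm_eq_abs]
  have h1 := trc_ge (m := m) (ht _ (hmem θ))
  have h2 := trc_le (m := m) (ht _ (hmem θ)) (hM _ (hmem θ)) (by have : (0:ℝ) ≤ m := by positivity
                                                                 linarith)
  rw [abs_of_nonneg (le_max_of_le_left hM0), abs_le]
  exact ⟨by linarith [le_max_right M (m:ℝ)], h2.trans (le_max_left _ _)⟩

lemma usc_approx {f : ℂ → EReal} (hf : UpperSemicontinuousOn f (sphere 0 1))
    (ht : ∀ ζ ∈ sphere (0:ℂ) 1, f ζ ≠ ⊤) (m : ℕ) {ε : ℝ} (hε : 0 < ε) :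
    ∃ g : ℂ → ℝ, Continuous g ∧ (∀ ζ ∈ sphere (0:ℂ) 1, f ζ ≤ g ζ) ∧
      Real.circleAverage g 0 1 ≤ Real.circleAverage (trc f m) 0 1 + ε := by
  obtain ⟨M, hM0, hM⟩ := usc_bdd hf ht
  have hm0 : (0:ℝ) ≤ m := by positivity
  have hmem : ∀ θ : ℝ, circleMap (0:ℂ) 1 θ ∈ sphere (0:ℂ) 1 := fun θ => by simp
  let S := sphere (0:ℂ) 1
  have : Nonempty S := ⟨⟨1, by simp [S]⟩⟩
  let F : S → ℝ := fun ω => trc f m ω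
  have hFM : ∀ ω : S, F ω ≤ M := fun ω => trc_le (ht _ ω.2) (hM _ ω.2) (by linarith)
  have hFm : ∀ ω : S, -(m:ℝ) ≤ F ω := fun ω => trc_ge (ht _ ω.2)
  let g : ℕ → ℂ → ℝ := fun k ζ => ⨆ ω : S, (F ω - k * dist ζ ω)
  have hbdd : ∀ (k : ℕ) (ζ : ℂ), BddAbove (range fun ω : S => F ω - k * dist ζ ω) := fun k ζ =>
    ⟨M, by rintro _ ⟨ω, rfl⟩; have := hFM ω
           have : 0 ≤ (k:ℝ) * dist ζ ω := by positivity
           show F ω - k * dist ζ ω ≤ M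
           linarith [hFM ω]⟩
  have hgM : ∀ (k : ℕ) (ζ : ℂ), g k ζ ≤ M := fun k ζ => ciSup_le fun ω => by
           have : 0 ≤ (k:ℝ) * dist ζ ω := by positivity
           linarith [hFM ω]
  have hgF : ∀ (k : ℕ) (ω : S), F ω ≤ g k ω := fun k ω => by
    have := le_ciSup (hbdd k ω) ω
    simpa [g] using this
  have hlip : ∀ k, Continuous (g k) := fun k => by
    refine (LipschitzWith.of_le_add_mul (k : NNReal) fun x y => ?_).continuous
    refine ciSup_le fun ω => ?_
    have h1 := le_ciSup (hbdd k y) ω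
    have h2 := dist_triangle y x ω
    have h3 : (k:ℝ) * dist y ω ≤ k * (dist x y + dist x ω) := by
      rw [dist_comm x y]; gcongr
    simp only [NNReal.coe_natCast]
    have h1' : F ω - k * dist y ω ≤ g k y := h1
    nlinarith
  have hlim : ∀ ω : S, Tendsto (fun k => g k ω) atTop (𝓝 (F ω)) := fun ω => by
    rw [Metric.tendsto_atTop]
    intro η hη
    have hlt : f ω < ((F ω + η/2 : ℝ) : EReal) := 
      ((trc_lt (ht _ ω.2) (m := m)).1 (show F ω < F ω + η/2 by linarith)).1
    have := hf ω ω.2 _ hlt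
    rw [eventually_nhdsWithin_iff, Metric.eventually_nhds_iff] at this
    obtain ⟨δ, hδ, hd⟩ := this
    obtain ⟨N, hN⟩ := exists_nat_gt ((M + m) / δ)
    refine ⟨N, fun k hk => ?_⟩
    have hNk : (N:ℝ) ≤ k := by exact_mod_cast hk
    have : g k ω ≤ F ω + η/2 := by
      refine ciSup_le fun τ => ?_
      by_cases hτ : dist (τ:ℂ) ω < δ
      · have h1 := hd hτ τ.2
        have h2 : F τ ≤ F ω + η/2 := trc_le (ht _ τ.2) h1.le (by linarith [hFm ω])
        have : 0 ≤ (k:ℝ) * dist (ω:ℂ) τ := by positivity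
        linarith
      · push Not at hτ
        rw [dist_comm] at hτ
        have h3 : (M + m) < k * δ := by
          rw [div_lt_iff₀ hδ] at hN
          exact hN.trans_le (by gcongr)
        have h4 : k * δ ≤ k * dist (ω:ℂ) τ := by gcongr
        linarith [hFM τ, hFm ω]
    rw [Real.dist_eq, abs_lt]
    exact ⟨by linarith [hgF k ω], by linarith⟩
  have hconv : Tendsto (fun k => Real.circleAverage (g k) 0 1) atTop
      (𝓝 (Real.circleAverage (trc f m) 0 1)) := by
    unfold Real.circleAverage
    refine Tendsto.const_smul ?_ _
    refine intervalIntegral.tendsto_integral_filter_of_dominated_convergence (fun _ => max M m)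
      ?_ ?_ (intervalIntegrable_const) ?_
    · refine Eventually.of_forall fun k => ?_
      exact ((hlip k).comp (continuous_circleMap 0 1)).aestronglyMeasurable
    · refine Eventually.of_forall fun k => Eventually.of_forall fun θ _ => ?_
      rw [Real.norm_eq_abs, abs_le]
      have h1 := hgF k ⟨_, hmem θ⟩
      have h2 := hFm ⟨_, hmem θ⟩
      have h3 := hgM k (circleMap 0 1 θ)
      exact ⟨by simp only at h1; linarith [le_max_right M (m:ℝ)], h3.trans (le_max_left _ _)⟩
    · exact Eventually.of_forall fun θ _ => hlim ⟨_, hmem θ⟩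
  obtain ⟨k, hk⟩ := (hconv.eventually_lt_const (show _ < Real.circleAverage (trc f m) 0 1 + ε by linarith)).exists
  refine ⟨g k, hlip k, fun ζ hζ => ?_, hk.le⟩
  exact (le_trc (m := m) (ht ζ hζ)).trans (by exact_mod_cast hgF k ⟨ζ, hζ⟩)

section
variable {E : Type*} [NormedAddCommGroup E] [NormedSpace ℂ E]

/-- sub-mean-value test against continuous majorants on the circle -/
def Tst (u : E → EReal) (a b : E) : Prop :=
  ∀ g : ℂ → ℝ, ContinuousOn g (sphere 0 1) → (∀ ζ ∈ sphere (0:ℂ) 1, u (a + ζ • b) ≤ g ζ) →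
    u a ≤ (Real.circleAverage g 0 1 : ℝ)

lemma truncCircleAvg_eq (u : E → EReal) (a b : E) (c : ℂ) (r : ℝ) (m : ℕ) :
    truncCircleAvg (fun ζ => u (a + ζ • b)) c r m =
      Real.circleAverage (trc (fun ζ => u ((a + c • b) + ζ • ((r:ℂ) • b))) m) 0 1 := by
  unfold truncCircleAvg Real.circleAverage trc circleMap
  simp only [smul_eq_mul]
  congr 2
  ext θ
  have : a + (c + (r:ℂ) * cexp (θ * I)) • b =
      a + c • b + ((0:ℂ) + ((1:ℝ):ℂ) * cexp (θ * I)) • ((r:ℂ) • b) := by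
    push_cast
    module
  rw [this]

lemma circInt_of_cont {g : ℂ → ℝ} (hg : ContinuousOn g (sphere 0 1)) : CircleIntegrable g 0 1 :=
  ContinuousOn.circleIntegrable (by norm_num) hg

lemma line_usc {u : E → EReal} {D : Set E} (hu : UpperSemicontinuousOn u D) {a b : E} {s : Set ℂ}
    (h : ∀ ζ ∈ s, a + ζ • b ∈ D) :
    UpperSemicontinuousOn (fun ζ : ℂ => u (a + ζ • b)) s :=
  hu.comp (g := fun ζ : ℂ => a + ζ • b) (by fun_prop) h

lemma tst_iff {u : E → EReal} {D : Set E} (hu : UpperSemicontinuousOn u D) (ht : ∀ z ∈ D, u z ≠ ⊤)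
    {a b : E} (h : ∀ ζ ∈ sphere (0:ℂ) 1, a + ζ • b ∈ D) : 
    Tst u a b ↔ ∀ m : ℕ, u a ≤ (Real.circleAverage (trc (fun ζ => u (a + ζ • b)) m) 0 1 : ℝ) := by
  have h1 := line_usc hu h
  have h2 : ∀ ζ ∈ sphere (0:ℂ) 1, u (a + ζ • b) ≠ ⊤ := fun ζ hζ => ht _ (h ζ hζ)
  constructor
  · intro hT m
    refine EReal.le_of_forall_lt_iff_le.1 fun z hz => ?_
    rw [EReal.coe_lt_coe_iff] at hz
    obtain ⟨g, hg, hfg, hav⟩ := usc_approx h1 h2 m (sub_pos.2 hz)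
    refine (hT g hg.continuousOn hfg).trans ?_
    exact_mod_cast hav.trans (by linarith)
  · intro hm g hg hfg
    obtain ⟨p, hp, hmin⟩ := (isCompact_sphere (0:ℂ) 1).exists_isMinOn sph_ne hg
    obtain ⟨m, hm'⟩ := exists_nat_gt (-(g p))
    refine (hm m).trans ?_
    rw [EReal.coe_le_coe_iff]
    refine Real.circleAverage_mono (trc_integrable h1 h2 m) (circInt_of_cont hg) ?_
    intro ζ hζ
    simp only [abs_one] at hζ
    exact trc_le (h2 ζ hζ) (hfg ζ hζ) (by have : g p ≤ g ζ := hmin hζ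
                                          linarith)

lemma psh_iff {u : E → EReal} {D : Set E} : PshOn u D ↔ UpperSemicontinuousOn u D ∧
    (∀ z ∈ D, u z ≠ ⊤) ∧ ∀ a b : E, (∀ ζ : ℂ, ‖ζ‖ ≤ 1 → a + ζ • b ∈ D) → Tst u a b := by
  constructor
  · rintro ⟨h1, h2, h3⟩
    refine ⟨h1, h2, fun a b hab => ?_⟩
    rw [tst_iff h1 h2 (fun ζ hζ => hab ζ (by simpa using hζ.le))]
    intro m
    have := (h3 a b).2 0 1 one_pos (fun ζ hζ => hab ζ (by simpa using hζ)) m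
    rw [truncCircleAvg_eq] at this
    simpa using this
  · rintro ⟨h1, h2, h3⟩
    refine ⟨h1, h2, fun a b => ⟨line_usc h1 (fun ζ hζ => hζ), ?_⟩⟩
    intro c r hr hsub m
    have hd : ∀ ζ : ℂ, ‖ζ‖ ≤ 1 → (a + c • b) + ζ • ((r:ℂ) • b) ∈ D := by
      intro ζ hζ
      have : c + ζ * r ∈ closedBall c r := by
        simp [abs_of_pos hr]
        nlinarith
      have := hsub this
      simp only [mem_ofPred_eq, add_smul, mul_smul] at this
      rwa [← add_assoc] at this
    rw [truncCircleAvg_eq]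
    exact (tst_iff h1 h2 (fun ζ hζ => hd ζ (by simpa using hζ.le))).1 (h3 _ _ hd) m

end

open Complex Metric MeasureTheory Filter Topology Set

/-- Continuous complex functions with the mean value property. -/
def MVP (H : ℂ → ℂ) : Prop := Continuous H ∧ ∀ p r, Real.circleAverage H p r = H p

lemma mvp_pow (n : ℕ) : MVP (fun z => z ^ n) :=
  ⟨by fun_prop, fun p r => DiffContOnCl.circleAverage (by
    exact (differentiable_pow n).diffContOnCl)⟩

lemma cont_circInt {F : Type*} [NormedAddCommGroup F] {H : ℂ → F} (h : Continuous H) (p : ℂ) (r : ℝ) : CircleIntegrable H p r :=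
  h.continuousOn.circleIntegrable'

lemma mvp_conj {H : ℂ → ℂ} (h : MVP H) : MVP (fun z => (starRingEnd ℂ) (H z)) := by
  refine ⟨by have := h.1; fun_prop, fun p r => ?_⟩
  have := ContinuousLinearMap.circleAverage_comp_comm (Complex.conjCLE : ℂ →L[ℝ] ℂ) (cont_circInt h.1 p r)
  rw [h.2 p r] at this
  exact this

lemma harm_approx {g : ℂ → ℝ} (hg : ContinuousOn g (sphere 0 1)) {ε : ℝ} (hε : 0 < ε) :
    ∃ H : ℂ → ℝ, Continuous H ∧ (∀ p r, Real.circleAverage H p r = H p) ∧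
      ∀ ζ ∈ sphere (0:ℂ) 1, |H ζ - g ζ| ≤ ε := by
  let W : Submodule ℂ C(AddCircle (1:ℝ), ℂ) :=
    { carrier := {f | ∃ H, MVP H ∧ ∀ x, f x = H (AddCircle.toCircle x)}
      add_mem' := by
        rintro f1 f2 ⟨H1, h1, e1⟩ ⟨H2, h2, e2⟩
        refine ⟨fun z => H1 z + H2 z, ⟨h1.1.add h2.1, fun p r => ?_⟩, fun x => by simp [e1, e2]⟩
        rw [Real.circleAverage_fun_add (cont_circInt h1.1 p r) (cont_circInt h2.1 p r), h1.2, h2.2]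
      zero_mem' := ⟨fun _ => 0, ⟨continuous_const, fun p r => Real.circleAverage_const _ _ _⟩, fun x => by simp⟩
      smul_mem' := by
        rintro c f1 ⟨H1, h1, e1⟩
        refine ⟨fun z => c • H1 z, ⟨h1.1.const_smul c, fun p r => ?_⟩, fun x => by simp [e1]⟩
        rw [Real.circleAverage_fun_smul, h1.2] }
  have hW : Submodule.span ℂ (range (@fourier 1)) ≤ W := by
    rw [Submodule.span_le]
    rintro _ ⟨n, rfl⟩
    obtain ⟨k, rfl | rfl⟩ := n.eq_nat_or_neg
    · exact ⟨_, mvp_pow k, fun x => by simp [AddCircle.toCircle_nsmul]⟩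
    · refine ⟨_, mvp_conj (mvp_pow k), fun x => ?_⟩
      rw [fourier_neg]
      simp [AddCircle.toCircle_nsmul]
  let G : C(AddCircle (1:ℝ), ℂ) := ⟨fun x => ((g (AddCircle.toCircle x) : ℝ) : ℂ), by
    refine Complex.continuous_ofReal.comp (hg.comp_continuous ?_ fun x => by
      simpa using Circle.norm_coe _)
    exact continuous_subtype_val.comp AddCircle.continuous_toCircle⟩
  have hG : G ∈ closure (W : Set C(AddCircle (1:ℝ), ℂ)) := by
    have : G ∈ (Submodule.span ℂ (range <| @fourier 1)).topologicalClosure := by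
      rw [span_fourier_closure_eq_top]; trivial
    exact closure_mono hW this
  rw [Metric.mem_closure_iff] at hG
  obtain ⟨f, ⟨H, hH, e⟩, hd⟩ := hG ε hε
  refine ⟨fun z => (H z).re, by have := hH.1; fun_prop, fun p r => ?_, fun ζ hζ => ?_⟩
  · have := ContinuousLinearMap.circleAverage_comp_comm Complex.reCLM (cont_circInt hH.1 p r)
    rw [hH.2 p r] at this
    exact this
  · obtain ⟨x, hx⟩ := (AddCircle.homeomorphCircle (T := 1) one_ne_zero).surjective
      ⟨ζ, by simpa [Submonoid.unitSphere] using hζ⟩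
    rw [AddCircle.homeomorphCircle_apply] at hx
    have hx' : ((AddCircle.toCircle x : Circle) : ℂ) = ζ := by rw [hx]
    have h1 := (ContinuousMap.dist_apply_le_dist (f := G) (g := f) x).trans hd.le
    rw [e x, hx', dist_comm, dist_eq_norm] at h1
    have h2 : G x = ((g ζ : ℝ) : ℂ) := by rw [← hx']; rfl
    rw [h2] at h1
    have h3 := (Complex.abs_re_le_norm (H ζ - (g ζ : ℝ))).trans h1
    simpa using h3

section
variable {E : Type*} [NormedAddCommGroup E] [InnerProductSpace ℂ E]

lemma avg_normsq (a b : E) :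
    Real.circleAverage (fun ζ : ℂ => ‖a + ζ • b‖ ^ 2) 0 1 = ‖a‖ ^ 2 + ‖b‖ ^ 2 := by
  have h0 : Real.circleAverage (fun ζ : ℂ => 2 * inner ℂ a b * ζ) 0 1 = 0 := by
    have := DiffContOnCl.circleAverage (f := (fun ζ : ℂ => 2 * inner ℂ a b * ζ)) (c := 0) (R := 1)
      (by exact (show Differentiable ℂ (fun ζ : ℂ => 2 * inner ℂ a b * ζ) by fun_prop).diffContOnCl)
    simpa using this
  have h1 := ContinuousLinearMap.circleAverage_comp_comm Complex.reCLM 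
    (cont_circInt (show Continuous (fun ζ : ℂ => 2 * inner ℂ a b * ζ) by fun_prop) 0 1)
  rw [h0] at h1
  have h2 : Real.circleAverage (fun ζ : ℂ => (‖a‖ ^ 2 + ‖b‖ ^ 2) + (reCLM ∘ (fun ζ : ℂ => 2 * inner ℂ a b * ζ)) ζ) 0 1
     = ‖a‖ ^ 2 + ‖b‖ ^ 2 := by
    rw [Real.circleAverage_fun_add (cont_circInt (by fun_prop) 0 1) (cont_circInt (by fun_prop) 0 1), h1,
      Real.circleAverage_const]
    simp
  rw [← h2]
  refine Real.circleAverage_congr_sphere fun ζ hζ => ?_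
  have hz : ‖ζ‖ = 1 := by simpa using hζ
  simp only [Function.comp]
  rw [norm_add_sq (𝕜 := ℂ), norm_smul, hz, one_mul, inner_smul_right]
  simp
  ring
end

lemma local_to_global {v : ℂ → EReal} (hv : UpperSemicontinuousOn v (closedBall 0 1))
    (ht : ∀ ζ ∈ closedBall (0:ℂ) 1, v ζ ≠ ⊤)
    (hloc : ∀ p ∈ ball (0:ℂ) 1, ∃ r : ℝ, 0 < r ∧ (∀ ζ : ℂ, ‖ζ‖ ≤ 1 → p + ζ • (r:ℂ) ∈ closedBall (0:ℂ) 1) ∧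
      Tst v p (r:ℂ)) : Tst v 0 1 := by
  intro g hg hvg
  simp only [smul_eq_mul, mul_one, zero_add] at hvg
  refine EReal.le_of_forall_lt_iff_le.1 fun z hz => ?_
  rw [EReal.coe_lt_coe_iff] at hz
  set ε := (z - Real.circleAverage g 0 1) / 3 with hε
  have hε0 : 0 < ε := by rw [hε]; linarith
  obtain ⟨H, hHc, hHm, hHg⟩ := harm_approx hg hε0
  have hH0 : H 0 ≤ Real.circleAverage g 0 1 + ε := by
    rw [← hHm 0 1]
    have : Real.circleAverage (fun ζ => g ζ + ε) 0 1 = Real.circleAverage g 0 1 + ε := by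
      rw [Real.circleAverage_fun_add (circInt_of_cont hg) (cont_circInt (by fun_prop) 0 1), 
        Real.circleAverage_const]
    rw [← this]
    refine Real.circleAverage_mono (cont_circInt hHc 0 1) (circInt_of_cont (by fun_prop)) ?_
    intro ζ hζ
    have := hHg ζ (by simpa using hζ)
    rw [abs_le] at this
    linarith
  let k : ℂ → ℝ := fun ζ => ε * ‖ζ‖ ^ 2 - H ζ
  have hk : Continuous k := by simp only [k]; fun_prop
  have husc : UpperSemicontinuousOn (fun ζ => v ζ + ((k ζ : ℝ) : EReal)) (closedBall 0 1) := by
    refine UpperSemicontinuousOn.add' hv 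
      (continuous_coe_real_ereal.comp hk).continuousOn.upperSemicontinuousOn ?_
    intro x hx
    exact EReal.continuousAt_add (Or.inl (ht x hx)) (Or.inr (by simp))
  obtain ⟨p, hp, hmax⟩ := husc.exists_isMaxOn ⟨0, by simp⟩ (isCompact_closedBall 0 1)
  have h0 : v 0 + ((k 0 : ℝ) : EReal) ≤ v p + ((k p : ℝ) : EReal) := hmax (by simp)
  have hconv : ∀ c : ℝ, v 0 + ((k 0 : ℝ) : EReal) ≤ c → v 0 ≤ ((c - k 0 : ℝ) : EReal) := by
    intro c hc
    rw [EReal.coe_sub, EReal.le_sub_iff_add_le (Or.inl (by simp)) (Or.inl (by simp))]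
    exact hc
  have hk0 : k 0 = - H 0 := by simp [k]
  by_cases hpb : ‖p‖ = 1
  · have hps : p ∈ sphere (0:ℂ) 1 := by simpa using hpb
    have h1 : v p + ((k p : ℝ) : EReal) ≤ ((g p + k p : ℝ) : EReal) := by
      rw [EReal.coe_add]; gcongr; exact hvg p hps
    refine (hconv _ (h0.trans h1)).trans ?_
    rw [EReal.coe_le_coe_iff, hk0]
    have := hHg p hps
    rw [abs_le] at this
    simp only [k, hpb]
    linarith
  · have hpball : p ∈ ball (0:ℂ) 1 := by
      simp at hp ⊢
      exact lt_of_le_of_ne hp hpb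
    by_cases hbot : v p = ⊥
    · rw [hbot, EReal.bot_add] at h0
      have := hconv (z + k 0) (h0.trans bot_le)
      simpa using this
    · exfalso
      obtain ⟨r, hr, hsub, hT⟩ := hloc p hpball
      lift v p to ℝ using ⟨ht p hp, hbot⟩ with w hw
      let q : ℂ → ℝ := fun ζ => w + k p - k (p + ζ • (r:ℂ))
      have hq : Continuous q := by simp only [q]; fun_prop
      have h1 := hT q hq.continuousOn (fun ζ hζ => by
        have h2 := hmax (hsub ζ (by simpa using hζ.le))
        simp only [mem_ofPred_eq] at h2
        rw [← hw, ← EReal.coe_add] at h2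
        simp only [q]
        rw [EReal.coe_sub, EReal.le_sub_iff_add_le (Or.inl (by simp)) (Or.inl (by simp))]
        exact h2)
      rw [← hw, EReal.coe_le_coe_iff] at h1
      have h3 : Real.circleAverage q 0 1 = w + k p - (ε * (‖p‖ ^ 2 + r ^ 2) - H p) := by
        have e1 : Real.circleAverage (fun ζ : ℂ => H (p + ζ • (r:ℂ))) 0 1 = H p := by
          rw [← hHm p r, Real.circleAverage_eq_circleAverage_zero_one (c := p)]
          congr 1
          ext ζ
          simp only [smul_eq_mul]
          congr 1
          ring
        have e2 : Real.circleAverage (fun ζ : ℂ => ε • ‖p + ζ • (r:ℂ)‖ ^ 2) 0 1 = ε * (‖p‖ ^ 2 + r ^ 2) := by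
          rw [Real.circleAverage_fun_smul, avg_normsq]
          simp
        simp only [q, k]
        rw [Real.circleAverage_fun_sub (cont_circInt (by fun_prop) 0 1) (cont_circInt (by fun_prop) 0 1),
          Real.circleAverage_const, Real.circleAverage_fun_sub (cont_circInt (by fun_prop) 0 1) (cont_circInt (by fun_prop) 0 1), e1]
        simp only [smul_eq_mul] at e2
        simp only [smul_eq_mul]
        rw [e2]
      rw [h3] at h1
      simp only [k] at h1
      have : 0 < ε * r ^ 2 := by positivity
      linarith

open Complex Metric MeasureTheory Filter Topology Set

section
variable {E : Type*} [NormedAddCommGroup E] [NormedSpace ℂ E]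

lemma line_cont {F : E → ℝ} {D : Set E} (hF : ContinuousOn F D) {a b : E}
    (h : ∀ ζ : ℂ, ‖ζ‖ ≤ 1 → a + ζ • b ∈ D) :
    ContinuousOn (fun ζ : ℂ => F (a + ζ • b)) (sphere 0 1) :=
  hF.comp (g := F) (f := fun ζ : ℂ => a + ζ • b) (by fun_prop) (fun ζ hζ => h ζ (by simpa using hζ.le))

lemma disc_center {D : Set E} {a b : E} (h : ∀ ζ : ℂ, ‖ζ‖ ≤ 1 → a + ζ • b ∈ D) : a ∈ D := by
  simpa using h 0 (by simp)

lemma psh_coe_iff {F : E → ℝ} {D : Set E} (hF : ContinuousOn F D) :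
    PshOn (fun z => ((F z : ℝ) : EReal)) D ↔ ∀ a b : E, (∀ ζ : ℂ, ‖ζ‖ ≤ 1 → a + ζ • b ∈ D) →
      F a ≤ Real.circleAverage (fun ζ : ℂ => F (a + ζ • b)) 0 1 := by
  rw [psh_iff]
  constructor
  · rintro ⟨_, _, h⟩ a b hab
    exact EReal.coe_le_coe_iff.1 (h a b hab _ (line_cont hF hab) (fun ζ _ => le_rfl))
  · intro h
    refine ⟨(continuous_coe_real_ereal.comp_continuousOn hF).upperSemicontinuousOn, by simp, ?_⟩
    intro a b hab g hg hgF
    refine EReal.coe_le_coe_iff.2 ((h a b hab).trans ?_)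
    refine Real.circleAverage_mono (circInt_of_cont (line_cont hF hab)) (circInt_of_cont hg) ?_
    intro ζ hζ
    exact EReal.coe_le_coe_iff.1 (hgF ζ (by simpa using hζ))

lemma psh_coe_add {F G : E → ℝ} {D : Set E} (hF : ContinuousOn F D) (hG : ContinuousOn G D)
    (pF : PshOn (fun z => ((F z : ℝ) : EReal)) D) (pG : PshOn (fun z => ((G z : ℝ) : EReal)) D) :
    PshOn (fun z => ((F z + G z : ℝ) : EReal)) D := by
  rw [psh_coe_iff hF] at pF
  rw [psh_coe_iff hG] at pG
  rw [psh_coe_iff (F := fun z => F z + G z) (hF.add hG)]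
  intro a b hab
  rw [Real.circleAverage_fun_add (circInt_of_cont (line_cont hF hab)) (circInt_of_cont (line_cont hG hab))]
  exact add_le_add (pF a b hab) (pG a b hab)

lemma psh_coe_smul {F : E → ℝ} {D : Set E} (hF : ContinuousOn F D) {c : ℝ} (hc : 0 ≤ c)
    (pF : PshOn (fun z => ((F z : ℝ) : EReal)) D) :
    PshOn (fun z => ((c * F z : ℝ) : EReal)) D := by
  rw [psh_coe_iff hF] at pF
  rw [psh_coe_iff (by fun_prop)]
  intro a b hab
  have := Real.circleAverage_fun_smul (a := c) (f := fun ζ : ℂ => F (a + ζ • b)) (c := 0) (R := 1)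
  simp only [smul_eq_mul] at this
  rw [this]
  exact mul_le_mul_of_nonneg_left (pF a b hab) hc

lemma psh_const (c : ℝ) (D : Set E) : PshOn (fun _ : E => ((c : ℝ) : EReal)) D := by
  rw [psh_coe_iff (F := fun _ => c) continuousOn_const]
  intro a b _
  rw [Real.circleAverage_const]

lemma psh_max {u v : E → EReal} {D : Set E} (hu : PshOn u D) (hv : PshOn v D) :
    PshOn (fun z => max (u z) (v z)) D := by
  rw [psh_iff] at *
  obtain ⟨u1, u2, u3⟩ := hu
  obtain ⟨v1, v2, v3⟩ := hv
  refine ⟨u1.sup v1, fun z hz => (max_lt (lt_top_iff_ne_top.2 (u2 z hz)) (lt_top_iff_ne_top.2 (v2 z hz))).ne, ?_⟩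
  intro a b hab g hg hgF
  exact max_le (u3 a b hab g hg fun ζ hζ => (le_max_left _ _).trans (hgF ζ hζ))
    (v3 a b hab g hg fun ζ hζ => (le_max_right _ _).trans (hgF ζ hζ))

lemma psh_congr {u v : E → EReal} {D : Set E} (hu : PshOn u D) (h : ∀ z ∈ D, u z = v z) :
    PshOn v D := by
  rw [psh_iff] at *
  obtain ⟨u1, u2, u3⟩ := hu
  refine ⟨fun z hz => ?_, fun z hz => h z hz ▸ u2 z hz, ?_⟩
  · exact (u1 z hz).congr_of_eventuallyEq hz (by
      filter_upwards [self_mem_nhdsWithin] with y hy using fun _ => by rw [h y hy])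
  · intro a b hab g hg hgF
    rw [← h a (disc_center hab)]
    refine u3 a b hab g hg fun ζ hζ => ?_
    rw [h _ (hab ζ (by simpa using hζ.le))]
    exact hgF ζ hζ

lemma psh_mono {u : E → EReal} {D D' : Set E} (hu : PshOn u D) (h : D' ⊆ D) : PshOn u D' := by
  rw [psh_iff] at *
  obtain ⟨u1, u2, u3⟩ := hu
  exact ⟨u1.mono h, fun z hz => u2 z (h hz), fun a b hab => u3 a b fun ζ hζ => h (hab ζ hζ)⟩

lemma psh_translate {u : E → EReal} {D : Set E} (hu : PshOn u D) (w : E) :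
    PshOn (fun z => u (z + w)) {z | z + w ∈ D} := by
  rw [psh_iff] at *
  obtain ⟨u1, u2, u3⟩ := hu
  refine ⟨u1.comp (g := fun z => z + w) (by fun_prop) (fun z hz => hz), fun z hz => u2 _ hz, ?_⟩
  intro a b hab g hg hgF
  have e : ∀ ζ : ℂ, a + w + ζ • b = a + ζ • b + w := fun ζ => by abel
  exact u3 (a + w) b (fun ζ hζ => by rw [e]; exact hab ζ hζ) g hg fun ζ hζ => by
    rw [e]; exact hgF ζ hζ

lemma psh_add_const {u : E → EReal} {D : Set E} (hu : PshOn u D) (c : ℝ) :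
    PshOn (fun z => u z + (c : EReal)) D := by
  rw [psh_iff] at *
  obtain ⟨u1, u2, u3⟩ := hu
  have key : ∀ (x : EReal) (y : ℝ), x + (c : EReal) ≤ y ↔ x ≤ ((y - c : ℝ) : EReal) := fun x y => by
    rw [EReal.coe_sub, EReal.le_sub_iff_add_le (Or.inl (by simp)) (Or.inl (by simp))]
  refine ⟨?_, fun z hz => ?_, ?_⟩
  · refine UpperSemicontinuousOn.add' u1 upperSemicontinuousOn_const ?_
    intro x hx
    exact EReal.continuousAt_add (Or.inl (u2 x hx)) (Or.inr (by simp))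
  · exact (EReal.add_lt_top (u2 z hz) (by simp)).ne
  intro a b hab g hg hgF
  rw [key]
  have := u3 a b hab (fun ζ => g ζ - c) (by fun_prop) fun ζ hζ => (key _ _).1 (hgF ζ hζ)
  rwa [Real.circleAverage_fun_sub (circInt_of_cont hg) (cont_circInt (by fun_prop) 0 1),
    Real.circleAverage_const] at this

lemma psh_of_local {u : E → EReal} {D : Set E}
    (h : ∀ z ∈ D, ∃ V : Set E, IsOpen V ∧ z ∈ V ∧ PshOn u V) : PshOn u D := by
  rw [psh_iff]
  have h1 : UpperSemicontinuousOn u D := fun z hz => by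
    obtain ⟨V, hV, hzV, hu⟩ := h z hz
    have := hu.1 z hzV
    have h2 : UpperSemicontinuousAt u z := fun y hy => by
      have := this y hy
      rwa [hV.nhdsWithin_eq hzV] at this
    exact h2.upperSemicontinuousWithinAt D
  have h2 : ∀ z ∈ D, u z ≠ ⊤ := fun z hz => by
    obtain ⟨V, hV, hzV, hu⟩ := h z hz
    exact hu.2.1 z hzV
  refine ⟨h1, h2, fun a b hab => ?_⟩
  have hcb : ∀ ζ ∈ closedBall (0:ℂ) 1, a + ζ • b ∈ D := fun ζ hζ => hab ζ (by simpa using hζ)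
  have : Tst (fun ζ : ℂ => u (a + ζ • b)) 0 1 := by
    refine local_to_global (line_usc h1 hcb) (fun ζ hζ => h2 _ (hcb ζ hζ)) ?_
    intro p hp
    obtain ⟨V, hV, hzV, hu⟩ := h (a + p • b) (hcb p (ball_subset_closedBall hp))
    have hopen : IsOpen (ball (0:ℂ) 1 ∩ (fun ζ : ℂ => a + ζ • b) ⁻¹' V) :=
      isOpen_ball.inter (hV.preimage (by fun_prop))
    obtain ⟨r, hr, hrs⟩ := Metric.nhds_basis_closedBall.mem_iff.1 (hopen.mem_nhds ⟨hp, hzV⟩)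
    have hmem : ∀ ζ : ℂ, ‖ζ‖ ≤ 1 → p + ζ • (r:ℂ) ∈ closedBall p r := fun ζ hζ => by
      simp [abs_of_pos hr]; nlinarith
    refine ⟨r, hr, fun ζ hζ => ball_subset_closedBall (hrs (hmem ζ hζ)).1, ?_⟩
    have e : ∀ ζ : ℂ, a + p • b + ζ • ((r:ℂ) • b) = a + (p + ζ • (r:ℂ)) • b := fun ζ => by
      rw [smul_eq_mul]; module
    have hT := (psh_iff.1 hu).2.2 (a + p • b) ((r:ℂ) • b) (fun ζ hζ => by
      rw [e]; exact (hrs (hmem ζ hζ)).2)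
    intro g hg hgF
    exact hT g hg fun ζ hζ => by rw [e]; exact hgF ζ hζ
  intro g hg hgF
  have := this g hg fun ζ hζ => by simpa using hgF ζ hζ
  simpa using this

open Classical in
lemma psh_glue {u h : E → EReal} {D Ω : Set E} (hD : IsOpen D) (hΩ : IsOpen Ω)
    (hh : PshOn h D) (hu : PshOn u Ω)
    (hb : ∀ z ∈ D, z ∉ Ω → ∀ᶠ y in 𝓝 z, y ∈ Ω → u y ≤ h y) :
    PshOn (fun z => if z ∈ Ω then max (u z) (h z) else h z) D := by
  refine psh_of_local fun z hz => ?_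
  by_cases hzΩ : z ∈ Ω
  · refine ⟨D ∩ Ω, hD.inter hΩ, ⟨hz, hzΩ⟩, ?_⟩
    refine psh_congr (psh_max (psh_mono hu inter_subset_right) (psh_mono hh inter_subset_left)) ?_
    intro y hy
    rw [if_pos hy.2]
  · obtain ⟨V, hVs, hV, hzV⟩ := _root_.eventually_nhds_iff.1 (hb z hz hzΩ)
    refine ⟨D ∩ V, hD.inter hV, ⟨hz, hzV⟩, ?_⟩
    refine psh_congr (psh_mono hh inter_subset_left) ?_
    intro y hy
    split_ifs with hyΩ
    · rw [max_eq_right (hVs y hy.2 hyΩ)]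
    · rfl

lemma psh_iInf {V : ℕ → E → ℝ} {D : Set E} (hc : ∀ l, ContinuousOn (V l) D)
    (hp : ∀ l, PshOn (fun z => ((V l z : ℝ) : EReal)) D) (hanti : ∀ z ∈ D, Antitone fun l => V l z) :
    PshOn (fun z => ⨅ l, ((V l z : ℝ) : EReal)) D := by
  rw [psh_iff]
  refine ⟨upperSemicontinuousOn_iInf fun l => (hp l).1, fun z hz => ?_, ?_⟩
  · exact ((iInf_le _ 0).trans_lt (EReal.coe_lt_top (V 0 z))).ne
  intro a b hab g hg hgF
  have key : ∀ ε > 0, ∃ l, ∀ ζ ∈ sphere (0:ℂ) 1, V l (a + ζ • b) ≤ g ζ + ε := by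
    intro ε hε
    have : ∃ l, ∀ ζ ∈ sphere (0:ℂ) 1, ζ ∈ sphere (0:ℂ) 1 → V l (a + ζ • b) ≤ g ζ + ε := by
      refine (isCompact_sphere (0:ℂ) 1).induction_on
        (p := fun s => ∃ l, ∀ ζ ∈ s, ζ ∈ sphere (0:ℂ) 1 → V l (a + ζ • b) ≤ g ζ + ε) ?_ ?_ ?_ ?_
      · exact ⟨0, by simp⟩
      · rintro s t hst ⟨l, hl⟩
        exact ⟨l, fun ζ hζ => hl ζ (hst hζ)⟩
      · rintro s t ⟨l, hl⟩ ⟨l', hl'⟩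
        refine ⟨max l l', ?_⟩
        rintro ζ (hζ | hζ) hs
        · exact (hanti _ (hab ζ (by simpa using hs.le)) (le_max_left _ _)).trans (hl ζ hζ hs)
        · exact (hanti _ (hab ζ (by simpa using hs.le)) (le_max_right _ _)).trans (hl' ζ hζ hs)
      · intro ζ hζ
        have h1 : (⨅ l, ((V l (a + ζ • b) : ℝ) : EReal)) < ((g ζ + ε : ℝ) : EReal) :=
          (hgF ζ hζ).trans_lt (by exact_mod_cast (by linarith))
        obtain ⟨l, hl⟩ := iInf_lt_iff.1 h1
        rw [EReal.coe_lt_coe_iff] at hl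
        refine ⟨_, ((line_cont (hc l) hab) ζ hζ).eventually_lt ((hg ζ hζ).add continuousWithinAt_const) hl, l, ?_⟩
        intro ω hω _
        exact le_of_lt hω
    obtain ⟨l, hl⟩ := this
    exact ⟨l, fun ζ hζ => hl ζ hζ hζ⟩
  refine EReal.le_of_forall_lt_iff_le.1 fun z hz => ?_
  rw [EReal.coe_lt_coe_iff] at hz
  obtain ⟨l, hl⟩ := key _ (sub_pos.2 hz)
  have h2 := (psh_iff.1 (hp l)).2.2 a b hab (fun ζ => g ζ + (z - Real.circleAverage g 0 1)) (by fun_prop)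
    fun ζ hζ => EReal.coe_le_coe_iff.2 (hl ζ hζ)
  rw [Real.circleAverage_fun_add (circInt_of_cont hg) (cont_circInt (by fun_prop) 0 1),
    Real.circleAverage_const] at h2
  refine (iInf_le _ l).trans (h2.trans ?_)
  exact_mod_cast (by linarith)

lemma polar_step {u : E → EReal} {D : Set E} (hu : PshOn u D) {a b : E}
    (hab : ∀ ζ : ℂ, ‖ζ‖ ≤ 1 → a + ζ • b ∈ D) (hbot : ∀ᶠ y in 𝓝 (a + b), u y = ⊥) : u a = ⊥ := by
  have husc := line_usc hu.1 (s := sphere (0:ℂ) 1) (fun ζ hζ => hab ζ (by simpa using hζ.le))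
  obtain ⟨M, -, hM⟩ := usc_bdd husc (fun ζ hζ => hu.2.1 _ (hab ζ (by simpa using hζ.le)))
  have h1 : ∀ᶠ ζ : ℂ in 𝓝 1, u (a + ζ • b) = ⊥ := by
    have : Tendsto (fun ζ : ℂ => a + ζ • b) (𝓝 1) (𝓝 (a + b)) := by
      have : Continuous (fun ζ : ℂ => a + ζ • b) := by fun_prop
      simpa using this.tendsto 1
    exact this.eventually hbot
  obtain ⟨η, hη, hd⟩ := Metric.eventually_nhds_iff.1 h1
  let B : ℂ → ℝ := fun ζ => max 0 (η - dist ζ 1)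
  have hB : Continuous B := by simp only [B]; fun_prop
  have hpos : 0 < Real.circleAverage B 0 1 := by
    unfold Real.circleAverage
    rw [smul_eq_mul]
    refine mul_pos (by positivity) ?_
    refine intervalIntegral.integral_pos (by positivity) (by fun_prop) (fun θ _ => le_max_left _ _) ?_
    refine ⟨0, by simp; positivity, ?_⟩
    simp [B, circleMap, hη]
  have h3 : ∀ k : ℕ, u a ≤ ((M - k * Real.circleAverage B 0 1 : ℝ) : EReal) := by
    intro k
    have := (psh_iff.1 hu).2.2 a b hab (fun ζ => M - (k:ℝ) • B ζ) (by fun_prop) (fun ζ hζ => by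
      by_cases hlt : dist ζ 1 < η
      · rw [hd hlt]; exact bot_le
      · have : B ζ = 0 := max_eq_left (by linarith)
        simpa [this] using hM ζ hζ)
    rw [Real.circleAverage_fun_sub (cont_circInt (by fun_prop) 0 1) (cont_circInt (by fun_prop) 0 1),
      Real.circleAverage_const, Real.circleAverage_fun_smul] at this
    simpa using this
  rw [EReal.eq_bot_iff_forall_lt]
  intro y
  obtain ⟨k, hk⟩ := exists_nat_gt ((M - y) / Real.circleAverage B 0 1)
  rw [div_lt_iff₀ hpos] at hk
  refine (h3 k).trans_lt ?_
  exact_mod_cast (by linarith)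

lemma polar_dense {u : E → EReal} {D : Set E} (hD : IsOpen D) (hc : IsPreconnected D) (hu : PshOn u D)
    (hne : ∃ z ∈ D, u z ≠ ⊥) {W : Set E} (hW : IsOpen W) (hWD : (D ∩ W).Nonempty) :
    ∃ z ∈ D ∩ W, u z ≠ ⊥ := by
  by_contra! hcon
  obtain ⟨z0, hz0, hz0'⟩ := hne
  let W0 := interior {z | z ∈ D ∧ u z = ⊥}
  have hsub : D ⊆ W0 := by
    refine hc.subset_of_closure_inter_subset isOpen_interior ?_ ?_
    · obtain ⟨x, hx⟩ := hWD
      refine ⟨x, hx.1, mem_interior.2 ⟨D ∩ W, fun y hy => ⟨hy.1, hcon y hy⟩, hD.inter hW, hx⟩⟩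
    · rintro a ⟨ha, haD⟩
      obtain ⟨δ, hδ, hball⟩ := Metric.isOpen_iff.1 hD a haD
      obtain ⟨p, hp, hpd⟩ := Metric.mem_closure_iff.1 ha (δ / 3) (by positivity)
      refine mem_interior.2 ⟨ball a (δ / 3), fun x hx => ?_, isOpen_ball, mem_ball_self (by positivity)⟩
      refine ⟨hball (ball_subset_ball (by linarith) hx), ?_⟩
      refine polar_step hu (b := p - x) (fun ζ hζ => hball ?_) ?_
      · rw [mem_ball, dist_eq_norm] at hx ⊢
        rw [dist_eq_norm] at hpd
        have e1 : ‖p - x‖ ≤ ‖a - p‖ + ‖x - a‖ := by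
          rw [norm_sub_rev a p, norm_sub_rev x a]
          have : p - x = (p - a) + (a - x) := by abel
          rw [this]; exact norm_add_le _ _
        have e2 : ‖x + ζ • (p - x) - a‖ ≤ ‖x - a‖ + ‖ζ‖ * ‖p - x‖ := by
          have : x + ζ • (p - x) - a = (x - a) + ζ • (p - x) := by abel
          rw [this, ← norm_smul]; exact norm_add_le _ _
        have e3 : ‖ζ‖ * ‖p - x‖ ≤ 1 * ‖p - x‖ := by gcongr
        linarith
      · rw [add_sub_cancel]
        filter_upwards [mem_interior_iff_mem_nhds.1 hp] with y hy using hy.2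
  exact hz0' (interior_subset (hsub hz0)).2

end

section
variable {E : Type*} [NormedAddCommGroup E] [InnerProductSpace ℂ E]

lemma psh_normsq (D : Set E) : PshOn (fun z : E => ((‖z‖ ^ 2 : ℝ) : EReal)) D := by
  rw [psh_coe_iff (F := fun z : E => ‖z‖ ^ 2) (by fun_prop)]
  intro a b _
  rw [avg_normsq]
  have : 0 ≤ ‖b‖ ^ 2 := by positivity
  linarith
end

open Complex Metric MeasureTheory Filter Topology Set

section
variable {E : Type*} [NormedAddCommGroup E] [InnerProductSpace ℂ E] [ProperSpace E]

lemma exists_rho [Nontrivial E] {D : Set E} (hD : IsBddDomain D) (hreg : BRegular D) :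
    ∃ ρ : E → ℝ, ContinuousOn ρ (closure D) ∧ PshOn (fun z => ((ρ z : ℝ) : EReal)) D ∧
      (∀ z ∈ frontier D, ρ z = 0) ∧ ∀ z ∈ D, ρ z < 0 := by
  obtain ⟨F, hF, pF, bF⟩ := hreg (fun z => -‖z‖ ^ 2) (by fun_prop)
  have hFD := hF.mono subset_closure
  have hρc : ContinuousOn (fun z => F z + ‖z‖ ^ 2) (closure D) := by fun_prop
  have hnomax : ∀ c ∈ D, ¬ (∀ z ∈ D, F z + ‖z‖ ^ 2 ≤ F c + ‖c‖ ^ 2) := by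
    intro c hc hmax
    obtain ⟨δ, hδ, hball⟩ := Metric.nhds_basis_closedBall.mem_iff.1 (hD.1.mem_nhds hc)
    obtain ⟨b, hb⟩ := exists_norm_eq E hδ.le
    have hdisc : ∀ ζ : ℂ, ‖ζ‖ ≤ 1 → c + ζ • b ∈ D := fun ζ hζ => hball (by
      simp [norm_smul, hb]; nlinarith)
    have h1 := (psh_coe_iff hFD).1 pF c b hdisc
    have hq : Continuous (fun ζ : ℂ => (F c + ‖c‖ ^ 2) - ‖c + ζ • b‖ ^ 2) := by fun_prop
    have h2 : Real.circleAverage (fun ζ : ℂ => F (c + ζ • b)) 0 1 ≤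
        Real.circleAverage (fun ζ : ℂ => (F c + ‖c‖ ^ 2) - ‖c + ζ • b‖ ^ 2) 0 1 := by
      refine Real.circleAverage_mono (circInt_of_cont (line_cont hFD hdisc)) (cont_circInt hq 0 1) ?_
      intro ζ hζ
      have := hmax _ (hdisc ζ (by simpa using (show ‖ζ‖ = 1 by simpa using hζ).le))
      linarith
    rw [Real.circleAverage_fun_sub (cont_circInt (by fun_prop) 0 1) (cont_circInt (by fun_prop) 0 1),
      Real.circleAverage_const, avg_normsq, hb] at h2
    have : 0 < δ ^ 2 := by positivity
    linarith
  have hcomp : IsCompact (closure D) := hD.2.2.isCompact_closure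
  obtain ⟨c, hc, hmax⟩ := hcomp.exists_isMaxOn hD.2.1.nonempty.closure hρc
  have hcf : c ∈ frontier D := by
    rw [hD.1.frontier_eq]
    exact ⟨hc, fun h => hnomax c h fun z hz => hmax (subset_closure hz)⟩
  have hle : ∀ z ∈ closure D, F z + ‖z‖ ^ 2 ≤ 0 := fun z hz => by
    have h1 : F z + ‖z‖ ^ 2 ≤ F c + ‖c‖ ^ 2 := hmax hz
    rw [bF c hcf] at h1
    linarith
  refine ⟨fun z => F z + ‖z‖ ^ 2, hρc, psh_coe_add hFD (by fun_prop) pF (psh_normsq D), ?_, ?_⟩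
  · intro z hz
    simp only [bF z hz]; ring
  · intro z hz
    refine lt_of_le_of_ne (hle z (subset_closure hz)) fun h0 => hnomax z hz fun y hy => ?_
    have h0' : F z + ‖z‖ ^ 2 = 0 := h0
    rw [h0']; exact hle y (subset_closure hy)

lemma exists_barrier [Nontrivial E] {D : Set E} (hD : IsBddDomain D) (hreg : BRegular D) {φ : E → ℝ}
    (hφ : Continuous φ) {ε : ℝ} (hε : 0 < ε) :
    ∃ h : E → ℝ, ContinuousOn h (closure D) ∧ PshOn (fun z => ((h z : ℝ) : EReal)) D ∧
      (∀ z ∈ closure D, h z ≤ φ z) ∧ ∀ z ∈ frontier D, h z = φ z - ε := by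
  obtain ⟨ρ, hρc, pρ, ρ0, ρneg⟩ := exists_rho hD hreg
  obtain ⟨H, hH, pH, bH⟩ := hreg φ hφ.continuousOn
  have hcomp : IsCompact (closure D) := hD.2.2.isCompact_closure
  have hρle : ∀ z ∈ closure D, ρ z ≤ 0 := fun z hz => by
    by_cases h : z ∈ D
    · exact (ρneg z h).le
    · exact (ρ0 z (by rw [hD.1.frontier_eq]; exact ⟨hz, h⟩)).le
  have key : ∃ C : ℝ, 0 ≤ C ∧ ∀ z ∈ closure D, H z + C * ρ z - ε ≤ φ z := by
    have hdc : ContinuousOn (fun z => H z - φ z) (closure D) := by fun_prop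
    have hT : IsCompact (closure D ∩ (fun z => H z - φ z) ⁻¹' (Ici ε)) :=
      hcomp.of_isClosed_subset (hdc.preimage_isClosed_of_isClosed isClosed_closure isClosed_Ici) inter_subset_left
    obtain ⟨M, hM⟩ := (hcomp.bddAbove_image hdc)
    rcases (closure D ∩ (fun z => H z - φ z) ⁻¹' (Ici ε)).eq_empty_or_nonempty with he | hne
    · refine ⟨0, le_rfl, fun z hz => ?_⟩
      by_contra hcon
      have : z ∈ closure D ∩ (fun z => H z - φ z) ⁻¹' (Ici ε) := ⟨hz, by simp; linarith⟩
      rw [he] at this; exact this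
    · obtain ⟨c, hc, hmax⟩ := hT.exists_isMaxOn hne (hρc.mono inter_subset_left)
      have hcneg : ρ c < 0 := by
        refine ρneg c ?_
        by_contra hcD
        have h1 := bH c (by rw [hD.1.frontier_eq]; exact ⟨hc.1, hcD⟩)
        have h2 : ε ≤ H c - φ c := hc.2
        linarith
      refine ⟨max M 0 / (-ρ c), div_nonneg (le_max_right _ _) (by linarith), fun z hz => ?_⟩
      have hC0 : 0 ≤ max M 0 / (-ρ c) := div_nonneg (le_max_right _ _) (by linarith)
      by_cases hzT : ε ≤ H z - φ z
      · have h1 : ρ z ≤ ρ c := hmax (show z ∈ _ from ⟨hz, hzT⟩)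
        have h2 : max M 0 / (-ρ c) * ρ z ≤ max M 0 / (-ρ c) * ρ c := by gcongr
        have h3 : max M 0 / (-ρ c) * ρ c = - max M 0 := by
          rw [div_neg, neg_mul, div_mul_cancel₀ _ hcneg.ne]
        have h4 : H z - φ z ≤ M := hM ⟨z, hz, rfl⟩
        linarith [le_max_left M 0]
      · have := mul_nonpos_of_nonneg_of_nonpos hC0 (hρle z hz)
        push Not at hzT
        linarith
  obtain ⟨C, hC, hle⟩ := key
  have hHD := hH.mono subset_closure
  have hρD := hρc.mono subset_closure
  refine ⟨fun z => H z + C * ρ z + (-ε), by fun_prop, ?_, fun z hz => by have := hle z hz; linarith, ?_⟩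
  · exact psh_coe_add (by fun_prop) (by fun_prop) (psh_coe_add hHD (by fun_prop) pH
      (psh_coe_smul hρD hC pρ)) (psh_const _ _)
  · intro z hz
    simp only [bH z hz, ρ0 z hz]; ring

open Classical in
lemma exists_shift [Nontrivial E] {D : Set E} (hD : IsBddDomain D) (hreg : BRegular D) {φ : E → ℝ}
    (hφ : Continuous φ) {ε : ℝ} (hε : 0 < ε) :
    ∃ δ > 0, ∀ u : E → EReal, PshOn u D → (∀ y ∈ D, u y ≤ φ y) → ∀ x ∈ D, ∀ y ∈ D, dist x y < δ →
      ∃ u' : E → EReal, PshOn u' D ∧ (∀ y ∈ D, u' y ≤ φ y) ∧ u x + ((-(3 * ε) : ℝ) : EReal) ≤ u' y := by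
  obtain ⟨h, hc, ph, hle, hbd⟩ := exists_barrier hD hreg hφ hε
  have hcomp : IsCompact (closure D) := hD.2.2.isCompact_closure
  obtain ⟨δ1, hδ1, hd1⟩ := Metric.uniformContinuousOn_iff.1
    (hcomp.uniformContinuousOn_of_continuous hφ.continuousOn) ε hε
  obtain ⟨δ2, hδ2, hd2⟩ := Metric.uniformContinuousOn_iff.1
    (hcomp.uniformContinuousOn_of_continuous hc) ε hε
  refine ⟨min δ1 δ2, lt_min hδ1 hδ2, fun u pu huφ x hx y hy hxy => ?_⟩
  set w := x - y with hw
  have hwn : ∀ z : E, dist (z + w) z < min δ1 δ2 := fun z => by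
    rw [dist_eq_norm] at hxy ⊢; simpa [hw] using hxy
  have hopen : IsOpen {z | z + w ∈ D} := hD.1.preimage (continuous_add_const w)
  have hshift : ∀ z : E, z + w ∈ D → ∀ B : ℝ, φ (z + w) ≤ B + 3 * ε → 
      u (z + w) + ((-(3 * ε) : ℝ) : EReal) ≤ B := by
    intro z hz B hB
    calc u (z + w) + ((-(3 * ε) : ℝ) : EReal) ≤ (φ (z + w) : EReal) + ((-(3 * ε) : ℝ) : EReal) := by
          gcongr; exact huφ _ hz
      _ = ((φ (z + w) + (-(3 * ε)) : ℝ) : EReal) := by rw [EReal.coe_add]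
      _ ≤ B := by exact_mod_cast (by linarith)
  refine ⟨_, psh_glue hD.1 hopen ph (psh_add_const (psh_translate pu w) (-(3 * ε))) ?_, ?_, ?_⟩
  · intro z hz hzn
    by_cases hcl : z + w ∈ closure D
    · have hfr : z + w ∈ frontier D := by rw [hD.1.frontier_eq]; exact ⟨hcl, hzn⟩
      have e1 : ∀ᶠ t in 𝓝[closure D] (z + w), φ t < h t + 2 * ε :=
        (hφ.continuousWithinAt).eventually_lt ((hc _ hcl).add continuousWithinAt_const)
          (by show φ (z + w) < h (z + w) + 2 * ε; rw [hbd _ hfr]; linarith)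
      rw [eventually_nhdsWithin_iff] at e1
      have e2 : ∀ᶠ t in 𝓝 z, t + w ∈ closure D → φ (t + w) < h (t + w) + 2 * ε :=
        ((continuous_add_const w).tendsto z).eventually e1
      filter_upwards [e2, hD.1.mem_nhds hz] with t ht htD htΩ
      refine hshift t htΩ _ ?_
      have h1 := ht (subset_closure htΩ)
      have h2 := hd2 (t + w) (subset_closure htΩ) t (subset_closure htD) ((hwn t).trans_le (min_le_right _ _))
      rw [Real.dist_eq, abs_lt] at h2
      linarith
    · have : ∀ᶠ t in 𝓝 z, t + w ∈ (closure D)ᶜ :=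
        ((continuous_add_const w).tendsto z).eventually (isClosed_closure.isOpen_compl.mem_nhds hcl)
      filter_upwards [this] with t ht htΩ
      exact absurd (subset_closure htΩ) ht
  · intro t ht
    split_ifs with htΩ
    · refine max_le (hshift t htΩ _ ?_) (by exact_mod_cast hle t (subset_closure ht))
      have h2 := hd1 (t + w) (subset_closure htΩ) t (subset_closure ht) ((hwn t).trans_le (min_le_left _ _))
      rw [Real.dist_eq, abs_lt] at h2
      linarith
    · exact_mod_cast hle t (subset_closure ht)
  · have hyw : y + w = x := by simp [hw]
    have : y ∈ {z | z + w ∈ D} := by show y + w ∈ D; rw [hyw]; exact hx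
    rw [if_pos this, hyw]
    exact le_max_left _ _

lemma exists_envelope [Nontrivial E] {D : Set E} (hD : IsBddDomain D) (hreg : BRegular D) {φ : E → ℝ}
    (hφ : Continuous φ) :
    ∃ v : E → ℝ, ContinuousOn v (closure D) ∧ PshOn (fun z => ((v z : ℝ) : EReal)) D ∧
      (∀ z ∈ closure D, v z ≤ φ z) ∧
      ∀ u : E → EReal, PshOn u D → (∀ y ∈ D, u y ≤ φ y) → ∀ y ∈ D, u y ≤ v y := by
  obtain ⟨h, hc, ph, hle, -⟩ := exists_barrier hD hreg hφ one_pos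
  let P : E → EReal := fun z => sSup {t | ∃ u : E → EReal, PshOn u D ∧ (∀ y ∈ D, u y ≤ φ y) ∧ t = u z}
  have hP1 : ∀ u : E → EReal, PshOn u D → (∀ y ∈ D, u y ≤ φ y) → ∀ y, u y ≤ P y := fun u pu hu y =>
    le_sSup ⟨u, pu, hu, rfl⟩
  have hP2 : ∀ y ∈ D, P y ≤ φ y := fun y hy => sSup_le (by rintro _ ⟨u, pu, hu, rfl⟩; exact hu y hy)
  have hP3 : ∀ y ∈ D, (((P y).toReal : ℝ) : EReal) = P y := fun y hy => by
    refine EReal.coe_toReal ((hP2 y hy).trans_lt (EReal.coe_lt_top _)).ne ?_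
    have := hP1 _ ph (fun y hy => by exact_mod_cast hle y (subset_closure hy)) y
    exact ((EReal.bot_lt_coe _).trans_le this).ne'
  let p : E → ℝ := fun z => (P z).toReal
  have huc : UniformContinuousOn p D := by
    rw [Metric.uniformContinuousOn_iff]
    intro ε hε
    obtain ⟨δ, hδ, hs⟩ := exists_shift hD hreg hφ (show 0 < ε / 4 by positivity)
    have one : ∀ x ∈ D, ∀ y ∈ D, dist x y < δ → p x ≤ p y + 3 * (ε / 4) := by
      intro x hx y hy hxy
      rw [← EReal.coe_le_coe_iff, show ((p x : ℝ) : EReal) = P x from hP3 x hx]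
      refine sSup_le ?_
      rintro _ ⟨u, pu, hu, rfl⟩
      obtain ⟨u', pu', hu', hxy'⟩ := hs u pu hu x hx y hy hxy
      have h1 := hxy'.trans (hP1 u' pu' hu' y)
      rw [← hP3 y hy] at h1
      have key : ∀ (x : EReal) (y c : ℝ), x + (c : EReal) ≤ y ↔ x ≤ ((y - c : ℝ) : EReal) := fun x y c => by
        rw [EReal.coe_sub, EReal.le_sub_iff_add_le (Or.inl (by simp)) (Or.inl (by simp))]
      rw [key, sub_neg_eq_add] at h1
      exact h1
    refine ⟨δ, hδ, fun x hx y hy hxy => ?_⟩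
    rw [Real.dist_eq, abs_lt]
    have h1 := one x hx y hy hxy
    have h2 := one y hy x hx (by rwa [dist_comm])
    constructor <;> linarith
  have hvc : ContinuousOn (extendFrom D p) (closure D) := by
    refine continuousOn_extendFrom le_rfl fun x hx => ?_
    have : (𝓝[D] x).NeBot := mem_closure_iff_nhdsWithin_neBot.1 hx
    have hca : Cauchy (map p (𝓝[D] x)) :=
      (cauchy_nhds.mono' this inf_le_left).map_of_le huc inf_le_right
    exact CompleteSpace.complete hca
  have hvp : ∀ z ∈ D, extendFrom D p z = p z := fun z hz =>
    extendFrom_eq (subset_closure hz) (huc.continuousOn z hz)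
  have hvP : ∀ z ∈ D, ((extendFrom D p z : ℝ) : EReal) = P z := fun z hz => by
    rw [hvp z hz]; exact hP3 z hz
  refine ⟨extendFrom D p, hvc, ?_, ?_, ?_⟩
  · rw [psh_iff]
    refine ⟨(continuous_coe_real_ereal.comp_continuousOn (hvc.mono subset_closure)).upperSemicontinuousOn,
      by simp, fun a b hab g hg hgF => ?_⟩
    simp only
    rw [hvP a (disc_center hab)]
    refine sSup_le ?_
    rintro _ ⟨u, pu, hu, rfl⟩
    refine (psh_iff.1 pu).2.2 a b hab g hg fun ζ hζ => (hP1 u pu hu _).trans ?_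
    rw [← hvP _ (hab ζ (by simpa using hζ.le))]
    exact hgF ζ hζ
  · intro z hz
    refine le_on_closure (fun x hx => ?_) hvc hφ.continuousOn hz
    rw [← EReal.coe_le_coe_iff, hvP x hx]
    exact hP2 x hx
  · intro u pu hu y hy
    rw [hvP y hy]
    exact hP1 u pu hu y

end

open Complex Metric MeasureTheory Filter Topology Set

section
variable {E : Type*} [NormedAddCommGroup E] [InnerProductSpace ℂ E] [ProperSpace E]

/-- Functions continuous on the closure, plurisubharmonic inside and nonpositive. -/
def Good (D : Set E) (v : E → ℝ) : Prop :=
  ContinuousOn v (closure D) ∧ PshOn (fun z => ((v z : ℝ) : EReal)) D ∧ ∀ z ∈ closure D, v z ≤ 0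

lemma key_local [Nontrivial E] {D A C : Set E} (hD : IsBddDomain D) (hreg : BRegular D)
    (hC : IsClosed C) (hCA : C ⊆ bHull A D) {z : E} (hz : z ∈ closure D) (hzA : z ∉ bHull A D)
    {ε : ℝ} (hε : 0 < ε) :
    ∃ v, Good D v ∧ (∀ x ∈ C, v x ≤ -1) ∧ -ε < v z := by
  have : ∃ u : E → EReal, PshOn u D ∧ (∀ y ∈ D, u y < 0) ∧ (∃ y ∈ D, u y ≠ ⊥) ∧
      (∀ x ∈ A, uscReg u D x = ⊥) ∧ uscReg u D z ≠ ⊥ := by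
    by_contra! hcon
    exact hzA ⟨hz, fun u h1 h2 h3 h4 => hcon u h1 h2 h3 h4⟩
  obtain ⟨u, pu, uneg, une, uA, uz⟩ := this
  have uC : ∀ x ∈ C, uscReg u D x = ⊥ := fun x hx => (hCA hx).2 u pu uneg une uA
  obtain ⟨t0, ht0⟩ := EReal.lt_iff_exists_real_btwn.1 (bot_lt_iff_ne_bot.2 uz)
  obtain ⟨t, htneg, htu⟩ : ∃ t : ℝ, t < 0 ∧ (t : EReal) < uscReg u D z :=
    ⟨min t0 (-1), by simp, lt_of_le_of_lt (by exact_mod_cast min_le_left _ _) ht0.2⟩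
  obtain ⟨M, hM, hMt⟩ : ∃ M : ℝ, 0 < M ∧ -ε * M < t :=
    ⟨-2 * t / ε, div_pos (by linarith) hε, by field_simp; linarith⟩
  let N : Set E := interior {y | y ∈ D → u y < ((-M : ℝ) : EReal)}
  have hCN : C ⊆ N := by
    intro x hx
    have h1 : limsup u (𝓝[D] x) < ((-M : ℝ) : EReal) := by
      rw [show limsup u (𝓝[D] x) = ⊥ from uC x hx]; exact EReal.bot_lt_coe _
    have h2 := eventually_lt_of_limsup_lt h1
    rw [eventually_nhdsWithin_iff] at h2
    exact mem_interior_iff_mem_nhds.2 h2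
  obtain ⟨f, f0, f1, f01⟩ := exists_continuous_zero_one_of_isClosed
    (isOpen_interior.isClosed_compl : IsClosed Nᶜ) hC
    (disjoint_left.2 fun x hx hxC => hx (hCN hxC))
  have hφ : Continuous (fun x => -M * f x) := by fun_prop
  obtain ⟨P, hPc, pP, hPφ, hPu⟩ := exists_envelope hD hreg hφ
  have huφ : ∀ y ∈ D, u y ≤ ((-M * f y : ℝ) : EReal) := by
    intro y hy
    by_cases hyN : y ∈ N
    · refine (interior_subset hyN hy).le.trans ?_
      have := (f01 y).2
      exact_mod_cast (by nlinarith)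
    · have : f y = 0 := f0 hyN
      rw [this]; simpa using (uneg y hy).le
  have hPz : t ≤ P z := by
    by_contra! hlt
    have h1 : ∀ᶠ y in 𝓝[closure D] z, P y < t := (hPc z hz).eventually_lt continuousWithinAt_const hlt
    have h2 : ∀ᶠ y in 𝓝[D] z, u y ≤ t := by
      filter_upwards [nhdsWithin_mono z subset_closure h1, self_mem_nhdsWithin] with y hy hyD
      refine (hPu u pu huφ y hyD).trans ?_
      exact_mod_cast (le_of_lt hy)
    have h3 : uscReg u D z ≤ t := limsup_le_of_le (by isBoundedDefault) h2
    exact absurd htu (not_lt.2 h3)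
  refine ⟨fun x => M⁻¹ * P x, ⟨by fun_prop, psh_coe_smul (hPc.mono subset_closure) (by positivity) pP, ?_⟩, ?_, ?_⟩
  · intro x hx
    have h1 : P x ≤ -M * f x := hPφ x hx
    have h2 := (f01 x).1
    exact mul_nonpos_of_nonneg_of_nonpos (by positivity) (by nlinarith)
  · intro x hx
    have h1 : P x ≤ -M * f x := hPφ x (hCA hx).1
    rw [f1 hx] at h1
    have h1' : P x ≤ - M := by simpa using h1
    calc M⁻¹ * P x ≤ M⁻¹ * (-M) := by gcongr
      _ = -1 := by field_simp
  · have : -ε * M < P z := hMt.trans_le hPz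
    show -ε < M⁻¹ * P z
    rw [inv_mul_eq_div, lt_div_iff₀ hM]; exact this

lemma key_lemma [Nontrivial E] {D A C K : Set E} (hD : IsBddDomain D) (hreg : BRegular D)
    (hC : IsClosed C) (hCA : C ⊆ bHull A D) (hK : IsCompact K) (hKD : K ⊆ closure D)
    (hKA : ∀ x ∈ K, x ∉ bHull A D) {ε : ℝ} (hε : 0 < ε) :
    ∃ v, Good D v ∧ (∀ x ∈ C, v x ≤ -1) ∧ ∀ x ∈ K, -ε ≤ v x := by
  refine hK.induction_on (p := fun K => ∃ v, Good D v ∧ (∀ x ∈ C, v x ≤ -1) ∧ ∀ x ∈ K, -ε ≤ v x) ?_ ?_ ?_ ?_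
  · exact ⟨fun _ => -1, ⟨continuousOn_const, psh_const _ _, by simp⟩, by simp, by simp⟩
  · rintro s t hst ⟨v, h1, h2, h3⟩
    exact ⟨v, h1, h2, fun x hx => h3 x (hst hx)⟩
  · rintro s t ⟨v, ⟨v1, v2, v3⟩, v4, v5⟩ ⟨w, ⟨w1, w2, w3⟩, w4, w5⟩
    refine ⟨fun x => max (v x) (w x), ⟨ContinuousOn.sup v1 w1, ?_, fun x hx => max_le (v3 x hx) (w3 x hx)⟩,
      fun x hx => max_le (v4 x hx) (w4 x hx), ?_⟩
    · exact psh_congr (psh_max v2 w2) fun z _ => (EReal.coe_strictMono.monotone.map_max).symm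
    · rintro x (hx | hx)
      · exact le_max_of_le_left (v5 x hx)
      · exact le_max_of_le_right (w5 x hx)
  · intro z hz
    obtain ⟨v, v1, v2, v3⟩ := key_local hD hreg hC hCA (hKD hz) (hKA z hz) hε
    refine ⟨{x | -ε < v x}, ?_, v, v1, v2, fun x hx => le_of_lt hx⟩
    exact nhdsWithin_mono z hKD (continuousWithinAt_const.eventually_lt (v1.1 z (hKD hz)) v3)

lemma dense_compl {D A : Set E} (hD : IsBddDomain D) (hbp : BPluripolar A D) {x : E}
    (hx : x ∈ closure D) {δ : ℝ} (hδ : 0 < δ) : ∃ z ∈ D, z ∉ bHull A D ∧ dist x z < δ := by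
  obtain ⟨u, pu, ule, une, uA⟩ := hbp
  have key : ∃ z ∈ D ∩ ball x δ, u z + ((-1 : ℝ) : EReal) ≠ ⊥ := by
    refine polar_dense (u := fun z => u z + ((-1 : ℝ) : EReal)) hD.1 hD.2.1.isPreconnected (psh_add_const pu (-1)) ?_ isOpen_ball ?_
    · obtain ⟨z, hz, h⟩ := une
      exact ⟨z, hz, by
        rw [ne_eq, EReal.add_eq_bot_iff, not_or]; exact ⟨h, EReal.coe_ne_bot _⟩⟩
    · obtain ⟨z, hz, h⟩ := Metric.mem_closure_iff.1 hx δ hδ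
      exact ⟨z, hz, by rwa [mem_ball, dist_comm]⟩
  obtain ⟨z, ⟨hzD, hzb⟩, hz⟩ := key
  refine ⟨z, hzD, fun hzA => hz ?_, by rwa [mem_ball, dist_comm] at hzb⟩
  have h1 := hzA.2 (fun z => u z + ((-1 : ℝ) : EReal)) (psh_add_const pu (-1)) ?_ ?_ ?_
  · have h2 : u z + ((-1 : ℝ) : EReal) ≤ uscReg (fun z => u z + ((-1 : ℝ) : EReal)) D z := by
      refine le_limsup_of_frequently_le ?_ (by isBoundedDefault)
      rw [frequently_iff]
      intro s hs
      exact ⟨z, mem_of_mem_nhdsWithin hzD hs, le_rfl⟩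
    rw [h1] at h2
    exact le_bot_iff.1 h2
  · intro y hy
    calc u y + ((-1 : ℝ) : EReal) ≤ 0 + ((-1 : ℝ) : EReal) := by gcongr; exact ule y hy
      _ < 0 := by rw [zero_add]; exact_mod_cast (by norm_num : (-1 : ℝ) < 0)
  · obtain ⟨z, hz, h⟩ := une
    exact ⟨z, hz, by
        rw [ne_eq, EReal.add_eq_bot_iff, not_or]; exact ⟨h, EReal.coe_ne_bot _⟩⟩
  · intro x hx
    refine le_bot_iff.1 ?_
    rw [← uA x hx]
    refine limsup_le_limsup (Eventually.of_forall fun y => ?_) (by isBoundedDefault) (by isBoundedDefault)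
    calc u y + ((-1 : ℝ) : EReal) ≤ u y + 0 := by gcongr; exact_mod_cast (by norm_num : (-1 : ℝ) ≤ 0)
      _ = u y := add_zero _

end

open Complex Metric MeasureTheory Filter Topology Set

section
variable {E : Type*} [NormedAddCommGroup E] [InnerProductSpace ℂ E] [ProperSpace E]

/-- Admissible states of the inductive construction. -/
def GoodState (A D : Set E) (p : (E → ℝ) × Set E) : Prop :=
  ContinuousOn p.1 (closure D) ∧ PshOn (fun z => ((p.1 z : ℝ) : EReal)) D ∧ p.2.Finite ∧
    p.2 ⊆ D ∧ ∀ x ∈ p.2, x ∉ bHull A D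

/-- One step of the inductive construction. -/
def StepRel (D C K : Set E) (ε δ : ℝ) (p q : (E → ℝ) × Set E) : Prop :=
  (∀ x ∈ closure D, q.1 x ≤ p.1 x) ∧ (∀ x ∈ C, q.1 x ≤ p.1 x - 1) ∧
    (∀ x ∈ K ∪ p.2, p.1 x - ε ≤ q.1 x) ∧ p.2 ⊆ q.2 ∧
    ∀ x ∈ K, ∃ z ∈ q.2, dist x z < δ ∧ q.1 x - 1 ≤ q.1 z

lemma exists_step [Nontrivial E] {D A C K : Set E} (hD : IsBddDomain D) (hreg : BRegular D)
    (hbp : BPluripolar A D)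
    (hC : IsClosed C) (hCA : C ⊆ bHull A D) (hK : IsCompact K) (hKD : K ⊆ closure D)
    (hKA : ∀ x ∈ K, x ∉ bHull A D) {ε δ : ℝ} (hε : 0 < ε) (hδ : 0 < δ)
    {p : (E → ℝ) × Set E} (hp : GoodState A D p) :
    ∃ q, GoodState A D q ∧ StepRel D C K ε δ p q := by
  obtain ⟨p1, p2, p3, p4, p5⟩ := hp
  have hcomp : IsCompact (closure D) := hD.2.2.isCompact_closure
  obtain ⟨v, ⟨v1, v2, v3⟩, v4, v5⟩ := key_lemma (K := K ∪ p.2) hD hreg hC hCA (hK.union p3.isCompact)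
    (union_subset hKD (p4.trans subset_closure))
    (fun x hx => hx.elim (hKA x) (p5 x)) hε
  have hVc : ContinuousOn (fun x => p.1 x + v x) (closure D) := p1.add v1
  obtain ⟨η, hη, huc⟩ := Metric.uniformContinuousOn_iff.1
    (hcomp.uniformContinuousOn_of_continuous hVc) 1 one_pos
  have hm : 0 < min δ η / 2 := by have := lt_min hδ hη; positivity
  obtain ⟨T, hTK, hTf, hT⟩ := hK.finite_cover_balls hm
  have hch : ∀ x ∈ T, ∃ z ∈ D, z ∉ bHull A D ∧ dist x z < min δ η / 2 := fun x hx =>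
    dense_compl hD hbp (hKD (hTK hx)) hm
  choose! g g1 g2 g3 using hch
  refine ⟨(fun x => p.1 x + v x, p.2 ∪ g '' T), ⟨hVc, ?_, p3.union (hTf.image g), ?_, ?_⟩, ?_, ?_, ?_, ?_, ?_⟩
  · exact psh_coe_add (p1.mono subset_closure) (v1.mono subset_closure) p2 v2
  · refine union_subset p4 ?_
    rintro _ ⟨x, hx, rfl⟩
    exact g1 x hx
  · rintro x (hx | ⟨y, hy, rfl⟩)
    · exact p5 x hx
    · exact g2 y hy
  · intro x hx
    have := v3 x hx
    show p.1 x + v x ≤ p.1 x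
    linarith
  · intro x hx
    have := v4 x hx
    show p.1 x + v x ≤ p.1 x - 1
    linarith
  · intro x hx
    have := v5 x hx
    show p.1 x - ε ≤ p.1 x + v x
    linarith
  · exact subset_union_left
  · intro x hx
    obtain ⟨y, hyT, hxy⟩ := mem_iUnion₂.1 (hT hx)
    have hd : dist x (g y) < min δ η := by
      have h1 := g3 y hyT
      have h2 := dist_triangle x y (g y)
      rw [mem_ball] at hxy
      linarith
    refine ⟨g y, Or.inr ⟨y, hyT, rfl⟩, hd.trans_le (min_le_left _ _), ?_⟩
    have h2 := huc x (hKD hx) (g y) (subset_closure (g1 y hyT)) (hd.trans_le (min_le_right _ _))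
    rw [Real.dist_eq, abs_lt] at h2
    show p.1 x + v x - 1 ≤ p.1 (g y) + v (g y)
    linarith

lemma exists_seq [Nontrivial E] {D A : Set E} {C K : ℕ → Set E} (hD : IsBddDomain D) (hreg : BRegular D)
    (hbp : BPluripolar A D)
    (hC : ∀ l, IsClosed (C l)) (hCA : ∀ l, C l ⊆ bHull A D) (hK : ∀ l, IsCompact (K l))
    (hKD : ∀ l, K l ⊆ closure D) (hKA : ∀ l, ∀ x ∈ K l, x ∉ bHull A D) :
    ∃ p : ℕ → (E → ℝ) × Set E, (∃ s ∈ D, p 0 = (fun _ => -1, {s})) ∧ (∀ l, GoodState A D (p l)) ∧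
      ∀ l, StepRel D (C l) (K l) ((1 / 2) ^ l) (1 / (l + 1)) (p l) (p (l + 1)) := by
  obtain ⟨d, hd⟩ := hD.2.1.nonempty
  obtain ⟨s, hs, hsA, -⟩ := dense_compl hD hbp (subset_closure hd) one_pos
  have h0 : GoodState A D (fun _ => -1, {s}) :=
    ⟨continuousOn_const, psh_const _ _, finite_singleton s, by simpa using hs, by simpa using hsA⟩
  have hstep : ∀ (l : ℕ) (p : (E → ℝ) × Set E), ∃ q, GoodState A D p →
      GoodState A D q ∧ StepRel D (C l) (K l) ((1 / 2) ^ l) (1 / (l + 1)) p q := by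
    intro l p
    by_cases hp : GoodState A D p
    · obtain ⟨q, hq⟩ := exists_step hD hreg hbp (hC l) (hCA l) (hK l) (hKD l) (hKA l)
        (show (0 : ℝ) < (1 / 2) ^ l by positivity) (show (0 : ℝ) < 1 / (l + 1) by positivity) hp
      exact ⟨q, fun _ => hq⟩
    · exact ⟨p, fun h => absurd h hp⟩
  choose next hnext using hstep
  let p : ℕ → (E → ℝ) × Set E := fun l => Nat.rec (fun _ => -1, {s}) (fun l q => next l q) l
  have hp : ∀ l, GoodState A D (p l) := fun l => by
    induction l with
    | zero => exact h0
    | succ l ih => exact (hnext l _ ih).1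
  exact ⟨p, ⟨s, hs, rfl⟩, hp, fun l => (hnext l _ (hp l)).2⟩

lemma main_aux [Nontrivial E] {D A : Set E} {C K : ℕ → Set E} (hD : IsBddDomain D) (hreg : BRegular D)
    (hbp : BPluripolar A D)
    (hC : ∀ l, IsClosed (C l)) (hCA : ∀ l, C l ⊆ bHull A D) (hK : ∀ l, IsCompact (K l))
    (hKD : ∀ l, K l ⊆ closure D) (hKA : ∀ l, ∀ x ∈ K l, x ∉ bHull A D)
    (hCm : Monotone C) (hKm : Monotone K) :
    ∃ ψ : E → EReal, PshOn ψ D ∧ (∀ z ∈ D, ψ z < 0) ∧ (∃ z ∈ D, ψ z ≠ ⊥) ∧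
      (∀ l, ∀ x ∈ C l, uscReg ψ D x = ⊥) ∧ ∀ l, ∀ x ∈ K l, uscReg ψ D x ≠ ⊥ := by
  obtain ⟨p, ⟨s, hs, hp0⟩, hg, hr⟩ := exists_seq hD hreg hbp hC hCA hK hKD hKA
  let V : ℕ → E → ℝ := fun l => (p l).1
  have hVc : ∀ l, ContinuousOn (V l) (closure D) := fun l => (hg l).1
  have hanti : ∀ z ∈ closure D, Antitone fun l => V l z := fun z hz =>
    antitone_nat_of_succ_le fun l => (hr l).1 z hz
  have hSm : Monotone fun l => (p l).2 := monotone_nat_of_le_succ fun l => (hr l).2.2.2.1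
  have hlow : ∀ l x, (∀ m, l ≤ m → x ∈ K m ∪ (p m).2) → ∀ k, V l x - 2 + 2 * (1 / 2) ^ k ≤ V (l + k) x := by
    intro l x hx k
    induction k with
    | zero => simp
    | succ k ih =>
      have h1 : V (l + k) x - (1 / 2) ^ (l + k) ≤ V (l + k + 1) x := (hr (l + k)).2.2.1 x (hx _ (by omega))
      have h2 : ((1 : ℝ) / 2) ^ (l + k) ≤ (1 / 2) ^ k :=
        pow_le_pow_of_le_one (by norm_num) (by norm_num) (by omega)
      rw [pow_succ, ← add_assoc]
      linarith
  have hlow2 : ∀ l x, x ∈ closure D → (∀ m, l ≤ m → x ∈ K m ∪ (p m).2) → ∀ m, V l x - 2 ≤ V m x := by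
    intro l x hxD hx m
    have h1 := hlow l x hx m
    have h2 : V (l + m) x ≤ V m x := hanti x hxD (by omega)
    have h3 : (0 : ℝ) < (1 / 2) ^ m := by positivity
    linarith
  let ψ : E → EReal := fun z => ⨅ l, ((V l z : ℝ) : EReal)
  have hψV : ∀ l z, ψ z ≤ (V l z : ℝ) := fun l z => iInf_le _ l
  have hV0 : ∀ z, V 0 z = -1 := fun z => by
    show (p 0).1 z = -1
    rw [hp0]
  refine ⟨ψ, psh_iInf (fun l => (hVc l).mono subset_closure) (fun l => (hg l).2.1)
    (fun z hz => hanti z (subset_closure hz)), fun z hz => ?_, ⟨s, hs, ?_⟩, ?_, ?_⟩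
  · refine (hψV 0 z).trans_lt ?_
    rw [hV0]; exact_mod_cast (by norm_num : (-1 : ℝ) < 0)
  · have hs0 : s ∈ (p 0).2 := by rw [hp0]; rfl
    have h1 : ((V 0 s - 2 : ℝ) : EReal) ≤ ψ s := le_iInf fun m => by
      exact_mod_cast hlow2 0 s (subset_closure hs) (fun m hm => Or.inr (hSm hm hs0)) m
    exact ((EReal.bot_lt_coe _).trans_le h1).ne'
  · intro l x hx
    have hxD : x ∈ closure D := (hCA l hx).1
    have h1 : ∀ k : ℕ, V (l + k) x ≤ -1 - k := by
      intro k
      induction k with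
      | zero =>
        have h1 : V (l + 0) x ≤ V 0 x := hanti x hxD (by omega)
        rw [hV0] at h1; simpa using h1
      | succ k ih =>
        have h2 : V (l + k + 1) x ≤ V (l + k) x - 1 := (hr (l + k)).2.1 x (hCm (by omega) hx)
        rw [← add_assoc]; push_cast; linarith
    have h2 : ∀ k : ℕ, uscReg ψ D x ≤ ((-k : ℝ) : EReal) := by
      intro k
      have h3 : ∀ᶠ y in 𝓝[closure D] x, V (l + k) y < -k :=
        (hVc (l + k) x hxD).eventually_lt continuousWithinAt_const (by linarith [h1 k])
      refine limsup_le_of_le (by isBoundedDefault) ?_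
      filter_upwards [nhdsWithin_mono x subset_closure h3] with y hy
      refine (hψV (l + k) y).trans ?_
      exact_mod_cast hy.le
    rw [EReal.eq_bot_iff_forall_lt]
    intro r
    obtain ⟨k, hk⟩ := exists_nat_gt (-r)
    exact (h2 k).trans_lt (EReal.coe_lt_coe_iff.2 (by linarith))
  · intro l x hx
    have hxD : x ∈ closure D := hKD l hx
    have hxK : ∀ m, l ≤ m → x ∈ K m := fun m hm => hKm hm hx
    have h1 : ((V l x - 5 : ℝ) : EReal) ≤ uscReg ψ D x := by
      refine le_limsup_of_frequently_le ?_ (by isBoundedDefault)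
      rw [frequently_iff]
      intro W hW
      obtain ⟨η, hη, hηW⟩ := Metric.mem_nhdsWithin_iff.1 hW
      obtain ⟨k, hk⟩ := exists_nat_one_div_lt hη
      obtain ⟨z, hz, hxz, hVz⟩ := (hr (l + k)).2.2.2.2 x (hxK _ (by omega))
      have hzD : z ∈ D := (hg (l + k + 1)).2.2.2.1 hz
      refine ⟨z, hηW ⟨?_, hzD⟩, ?_⟩
      · rw [mem_ball, dist_comm]
        refine hxz.trans_le (le_trans ?_ hk.le)
        push_cast
        gcongr
        linarith [(Nat.cast_nonneg l : (0 : ℝ) ≤ l)]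
      · refine le_iInf fun m => ?_
        have h2 := hlow2 l x hxD (fun m hm => Or.inl (hxK m hm)) (l + k + 1)
        have h3 := hlow2 (l + k + 1) z (subset_closure hzD) (fun m hm => Or.inr (hSm hm hz)) m
        have h4 : V (l + k + 1) x - 1 ≤ V (l + k + 1) z := hVz
        exact_mod_cast (by linarith)
    exact ((EReal.bot_lt_coe _).trans_le h1).ne'

end

/-- boundary version of Zeriahi's theorem.  Let `D` be B-regular,
`A ⊆ ∂D` b-pluripolar, `F` an `F_σ` and `G` a `G_δ` in `cl(D)` with `F ⊆ Â ⊆ G`.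
Then there is a negative `ψ ∈ PSH(D)`, `ψ ≢ -∞`, whose set
`E = {z ∈ cl(D) : ψ*(z) = -∞}` satisfies `F ⊆ E ⊆ G`. -/
theorem exists_psh_between_Fsigma_Gdelta {n : ℕ}
    (D A F G : Set (EuclideanSpace ℂ (Fin n))) (hD : IsBddDomain D)
    (hreg : BRegular D) (hA : A ⊆ frontier D) (hbp : BPluripolar A D)
    -- `F` is an `F_σ` in `cl(D)`:
    (hF : ∃ C : ℕ → Set (EuclideanSpace ℂ (Fin n)),
      (∀ j, IsClosed (C j)) ∧ (∀ j, C j ⊆ closure D) ∧ F = ⋃ j, C j)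
    -- `G` is a `G_δ` in `cl(D)`:
    (hG : ∃ U : ℕ → Set (EuclideanSpace ℂ (Fin n)),
      (∀ j, IsOpen (U j)) ∧ G = (⋂ j, U j) ∩ closure D)
    (hFsub : F ⊆ bHull A D) (hGsub : bHull A D ⊆ G) :
    ∃ ψ : EuclideanSpace ℂ (Fin n) → EReal,
      PshOn ψ D ∧ (∀ z ∈ D, ψ z < 0) ∧ (∃ z ∈ D, ψ z ≠ ⊥) ∧
      F ⊆ {z ∈ closure D | uscReg ψ D z = ⊥} ∧
      {z ∈ closure D | uscReg ψ D z = ⊥} ⊆ G := by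
  rcases Nat.eq_zero_or_pos n with rfl | hn
  · -- zero-dimensional case
    obtain ⟨d, hd⟩ := hD.2.1.nonempty
    have hDu : D = univ := eq_univ_of_forall fun x => by rwa [Subsingleton.elim x d]
    have hAe : ∀ x, x ∉ A := fun x hx => by have := hA hx; rw [hDu, frontier_univ] at this; exact this
    have hneg : ∀ z ∈ D, ((-1 : ℝ) : EReal) < 0 := fun _ _ => by
      exact_mod_cast (by norm_num : (-1 : ℝ) < 0)
    have hreg1 : ∀ z ∈ closure D, uscReg (fun _ : EuclideanSpace ℂ (Fin 0) => ((-1 : ℝ) : EReal)) D z ≠ ⊥ := by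
      intro z hz
      have : (𝓝[D] z).NeBot := mem_closure_iff_nhdsWithin_neBot.1 hz
      rw [uscReg, limsup_const]
      exact EReal.coe_ne_bot _
    refine ⟨fun _ => ((-1 : ℝ) : EReal), psh_const _ _, hneg, ⟨d, hd, EReal.coe_ne_bot _⟩, ?_, ?_⟩
    · intro x hx
      have h := hFsub hx
      exact absurd (h.2 _ (psh_const (-1) D) hneg ⟨d, hd, EReal.coe_ne_bot _⟩ fun x hx => absurd hx (hAe x))
        (hreg1 x h.1)
    · intro x hx
      exact absurd hx.2 (hreg1 x hx.1)
  · have : Nonempty (Fin n) := ⟨⟨0, hn⟩⟩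
    obtain ⟨C, hC1, hC2, rfl⟩ := hF
    obtain ⟨U, hU, rfl⟩ := hG
    have hcomp : IsCompact (closure D) := hD.2.2.isCompact_closure
    have hKc : ∀ i, IsCompact (closure D \ U i) := fun i => hcomp.diff (hU i)
    obtain ⟨ψ, h1, h2, h3, h4, h5⟩ := main_aux (C := fun l => ⋃ i ∈ Iic l, C i)
      (K := fun l => ⋃ i ∈ Iic l, closure D \ U i) hD hreg hbp
      (fun l => (finite_Iic l).isClosed_biUnion fun i _ => hC1 i)
      (fun l => iUnion₂_subset fun i _ => (subset_iUnion C i).trans hFsub)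
      (fun l => (finite_Iic l).isCompact_biUnion fun i _ => hKc i)
      (fun l => iUnion₂_subset fun i _ => sdiff_subset)
      (fun l x hx hxA => by
        obtain ⟨i, _, hi⟩ := mem_iUnion₂.1 hx
        exact hi.2 (mem_iInter.1 (hGsub hxA).1 i))
      (fun a b hab => biUnion_subset_biUnion_left (Iic_subset_Iic.2 hab))
      (fun a b hab => biUnion_subset_biUnion_left (Iic_subset_Iic.2 hab))
    refine ⟨ψ, h1, h2, h3, ?_, ?_⟩
    · intro x hx
      obtain ⟨i, hi⟩ := mem_iUnion.1 hx
      exact ⟨hC2 i hi, h4 i x (mem_iUnion₂.2 ⟨i, mem_Iic.2 le_rfl, hi⟩)⟩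
    · intro x hx
      refine ⟨mem_iInter.2 fun i => ?_, hx.1⟩
      by_contra hxi
      exact h5 i x (mem_iUnion₂.2 ⟨i, mem_Iic.2 le_rfl, hx.1, hxi⟩) hx.2
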